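/- Assume β = ϖ1 in Case [N1], or β = ϖ1 in Case [N2] with ρ ≠ Υ. Then every positive solution u of equation (E) in Ω∖{0} satisfies |x|^{ϖ1} |log|x||^{1/(q−1)} u(x) → ( |ϖ1| (1 − λτ|ϖ1|^{−τ−1}) / (q−1) )^{1/(q−1)} as |x| → 0. -/

import Mathlib

open MeasureTheory Filter Topology Real RealInnerProductSpace

noncomputable section

/-- The gradient factor `G_τ(x,z,ξ) = z^τ ‖ξ‖^(1-τ) / ‖x‖^(τ+1)`.
For `τ = 0` this equals `‖ξ‖ / ‖x‖`, since `z ^ (0:ℝ) = 1` for real powers. -/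
def Gt {N : ℕ} (τ : ℝ) (x : EuclideanSpace ℝ (Fin N)) (z : ℝ)
    (ξ : EuclideanSpace ℝ (Fin N)) : ℝ :=
  z ^ τ * ‖ξ‖ ^ (1 - τ) / ‖x‖ ^ (τ + 1)

/-- Test functions: `C¹` functions with compact support contained in `Ω \ {0}`. -/
def IsTestFun {N : ℕ} (Ω : Set (EuclideanSpace ℝ (Fin N)))
    (φ : EuclideanSpace ℝ (Fin N) → ℝ) : Prop :=
  ContDiff ℝ 1 φ ∧ HasCompactSupport φ ∧ tsupport φ ⊆ Ω \ {0}

/-- The distributional pairing of equation (E) with a test function `φ`: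
`∫ ∇u·∇φ + (N-2+2ρ) ∫ ((x·∇u)/|x|²) φ - λ ∫ G_τ(x,u,∇u) φ + ∫ |x|^θ u^q φ`. -/
def weakE (N : ℕ) (ρ lam τ θ q : ℝ) (Ω : Set (EuclideanSpace ℝ (Fin N)))
    (u φ : EuclideanSpace ℝ (Fin N) → ℝ) : ℝ :=
  (∫ x in Ω \ {0}, ⟪gradient u x, gradient φ x⟫)
    + ((N : ℝ) - 2 + 2 * ρ) * (∫ x in Ω \ {0}, ⟪x, gradient u x⟫ / ‖x‖ ^ 2 * φ x)
    - lam * (∫ x in Ω \ {0}, Gt τ x (u x) (gradient u x) * φ x)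
    + ∫ x in Ω \ {0}, ‖x‖ ^ θ * u x ^ q * φ x

/-- A positive `C¹` function on `Ω \ {0}`. -/
def PosC1 {N : ℕ} (Ω : Set (EuclideanSpace ℝ (Fin N)))
    (u : EuclideanSpace ℝ (Fin N) → ℝ) : Prop :=
  ContDiffOn ℝ 1 u (Ω \ {0}) ∧ ∀ x ∈ Ω \ {0}, 0 < u x

/-- Positive distributional solution of equation (E) in `Ω \ {0}`. -/
def IsSolutionE (N : ℕ) (ρ lam τ θ q : ℝ) (Ω : Set (EuclideanSpace ℝ (Fin N)))
    (u : EuclideanSpace ℝ (Fin N) → ℝ) : Prop :=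
  PosC1 Ω u ∧ ∀ φ, IsTestFun Ω φ → weakE N ρ lam τ θ q Ω u φ = 0

/-- Positive sub-solution of equation (E) in `Ω \ {0}`. -/
def IsSubSolutionE (N : ℕ) (ρ lam τ θ q : ℝ) (Ω : Set (EuclideanSpace ℝ (Fin N)))
    (u : EuclideanSpace ℝ (Fin N) → ℝ) : Prop :=
  PosC1 Ω u ∧ ∀ φ, IsTestFun Ω φ → (∀ x, 0 ≤ φ x) → weakE N ρ lam τ θ q Ω u φ ≤ 0

/-- Positive super-solution of equation (E) in `Ω \ {0}`. -/
def IsSuperSolutionE (N : ℕ) (ρ lam τ θ q : ℝ) (Ω : Set (EuclideanSpace ℝ (Fin N)))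
    (u : EuclideanSpace ℝ (Fin N) → ℝ) : Prop :=
  PosC1 Ω u ∧ ∀ φ, IsTestFun Ω φ → (∀ x, 0 ≤ φ x) → 0 ≤ weakE N ρ lam τ θ q Ω u φ

/-- `f_ρ(t) = t (t + 2ρ) + λ |t|^(1-τ)`. -/
def fRho (ρ lam τ t : ℝ) : ℝ := t * (t + 2 * ρ) + lam * |t| ^ (1 - τ)

/-- `Υ = ((τ+1)/(2τ)) (λτ)^(1/(τ+1))`. -/
def Upsilon (lam τ : ℝ) : ℝ := ((τ + 1) / (2 * τ)) * (lam * τ) ^ (1 / (τ + 1))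

/-- Case [N₀]: (a) `τ = 0` and `λ ≥ 2ρ`, or (b) `λ > 0`, `τ ∈ (0,1)` and `ρ < Υ`. -/
def CaseN0 (ρ lam τ : ℝ) : Prop :=
  (τ = 0 ∧ 2 * ρ ≤ lam) ∨ (0 < lam ∧ 0 < τ ∧ τ < 1 ∧ ρ < Upsilon lam τ)

/-- Case [N₁]: (a) `τ = 0` and `λ < 2ρ`, or (b) `λ < 0` and `τ ∈ (0,1)`. -/
def CaseN1 (ρ lam τ : ℝ) : Prop :=
  (τ = 0 ∧ lam < 2 * ρ) ∨ (lam < 0 ∧ 0 < τ ∧ τ < 1)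

/-- Case [N₂]: `λ > 0`, `τ ∈ (0,1)` and `ρ ≥ Υ`. -/
def CaseN2 (ρ lam τ : ℝ) : Prop :=
  0 < lam ∧ 0 < τ ∧ τ < 1 ∧ Upsilon lam τ ≤ ρ

/-- `w` is the smallest negative root of `f_ρ` (i.e. `w = ϖ₁`). -/
def IsMinNegRoot (ρ lam τ w : ℝ) : Prop :=
  w < 0 ∧ fRho ρ lam τ w = 0 ∧ ∀ t, t < 0 → fRho ρ lam τ t = 0 → w ≤ t

/-- `w` is the largest negative root of `f_ρ` (i.e. `w = ϖ₂`). -/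
def IsMaxNegRoot (ρ lam τ w : ℝ) : Prop :=
  w < 0 ∧ fRho ρ lam τ w = 0 ∧ ∀ t, t < 0 → fRho ρ lam τ t = 0 → t ≤ w

/-- `Φ_{ϖ₂}(r)`: equal to `r^(-ϖ₂)` if `ρ > Υ` and to `r^(-ϖ₂) |log r|^(2/(1+τ))` if `ρ = Υ`. -/
def Phi2 (ρ lam τ w2 r : ℝ) : ℝ :=
  if ρ = Upsilon lam τ then r ^ (-w2) * |Real.log r| ^ (2 / (1 + τ)) else r ^ (-w2)

/-- `Ψ_{ϖ₁}(t)`: equal to `t^(-ϖ₁)` if `ρ > Υ` and to `t^(-ϖ₁) (log t)^(2/(1+τ))` if `ρ = Υ`. -/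
def Psi1 (ρ lam τ w1 t : ℝ) : ℝ :=
  if ρ = Upsilon lam τ then t ^ (-w1) * (Real.log t) ^ (2 / (1 + τ)) else t ^ (-w1)

/-- The radial operator `L_{ρ,λ,τ}[P](r) = P'' + (1-2ρ) P'/r + λ P^τ |P'|^(1-τ)/r^(1+τ)`. -/
def Lrad (ρ lam τ : ℝ) (P : ℝ → ℝ) (r : ℝ) : ℝ :=
  deriv (deriv P) r + (1 - 2 * ρ) * deriv P r / r
    + lam * P r ^ τ * |deriv P r| ^ (1 - τ) / r ^ (1 + τ)

/-- The Laplacian of `u` at `x`, as the trace of the second derivative. -/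
def lapl {N : ℕ} (u : EuclideanSpace ℝ (Fin N) → ℝ) (x : EuclideanSpace ℝ (Fin N)) : ℝ :=
  ∑ i : Fin N, iteratedFDeriv ℝ 2 u x ![EuclideanSpace.single i 1, EuclideanSpace.single i 1]

section MaximumPrinciple

variable {N : ℕ}

local notation "𝔼" => EuclideanSpace ℝ (Fin N)

/-- A function continuous on an open set times a continuous function compactly supported in that
set is continuous. -/
lemma continuous_mul_of_tsupport_subset {X : Type*} [TopologicalSpace X] {U : Set X}
    (hU : IsOpen U) {F φ : X → ℝ} (hF : ContinuousOn F U) (hφ : Continuous φ)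
    (hs : tsupport φ ⊆ U) : Continuous fun x => F x * φ x := by
  rw [continuous_iff_continuousAt]
  intro x
  by_cases hx : x ∈ tsupport φ
  · exact (hF.continuousAt (hU.mem_nhds (hs hx))).mul hφ.continuousAt
  · have h0 : φ =ᶠ[𝓝 x] 0 := notMem_tsupport_iff_eventuallyEq.mp hx
    have h1 : (fun x => F x * φ x) =ᶠ[𝓝 x] fun _ => 0 := by
      filter_upwards [h0] with y hy
      simp [hy]
    exact continuousAt_const.congr h1.symm

lemma integrable_mul_of_tsupport_subset {U : Set 𝔼} (hU : IsOpen U) {F φ : 𝔼 → ℝ}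
    (hF : ContinuousOn F U) (hφ : Continuous φ) (hc : HasCompactSupport φ)
    (hs : tsupport φ ⊆ U) : Integrable fun x => F x * φ x :=
  (continuous_mul_of_tsupport_subset hU hF hφ hs).integrable_of_hasCompactSupport hc.mul_left

/-- A `C¹` function on an open set times a `C¹` function compactly supported in it is `C¹`. -/
lemma contDiff_mul_of_tsupport_subset {U : Set 𝔼} (hU : IsOpen U) {F φ : 𝔼 → ℝ}
    (hF : ContDiffOn ℝ 1 F U) (hφ : ContDiff ℝ 1 φ) (hs : tsupport φ ⊆ U) :
    ContDiff ℝ 1 fun x => F x * φ x := by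
  rw [contDiff_iff_contDiffAt]
  intro x
  by_cases hx : x ∈ tsupport φ
  · exact (hF.contDiffAt (hU.mem_nhds (hs hx))).mul hφ.contDiffAt
  · have h0 : φ =ᶠ[𝓝 x] 0 := notMem_tsupport_iff_eventuallyEq.mp hx
    have h1 : (fun x => F x * φ x) =ᶠ[𝓝 x] fun _ => 0 := by
      filter_upwards [h0] with y hy
      simp [hy]
    exact contDiffAt_const.congr_of_eventuallyEq h1

/-- Euler's identity in integrated form: `∫ ∇Φ · (x - a) = -N ∫ Φ`. -/
lemma integral_fderiv_apply_sub (a : 𝔼) {Φ : 𝔼 → ℝ} (hΦ : ContDiff ℝ 1 Φ)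
    (hc : HasCompactSupport Φ) :
    ∫ x, fderiv ℝ Φ x (x - a) = -(N * ∫ x, Φ x) := by
  have hcd : ∀ v : 𝔼, Continuous fun x => fderiv ℝ Φ x v := fun v =>
    (hΦ.continuous_fderiv one_ne_zero).clm_apply continuous_const
  have hcs : ∀ v : 𝔼, HasCompactSupport fun x => fderiv ℝ Φ x v := fun v => hc.fderiv_apply ℝ v
  have hint : ∀ i : Fin N, Integrable fun x : 𝔼 =>
      (x i - a i) * fderiv ℝ Φ x (EuclideanSpace.single i 1) := by
    intro i
    refine Continuous.integrable_of_hasCompactSupport ?_ (hcs _).mul_left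
    exact Continuous.mul (by fun_prop) (hcd _)
  have hexp : ∀ x : 𝔼, fderiv ℝ Φ x (x - a) =
      ∑ i, (x i - a i) * fderiv ℝ Φ x (EuclideanSpace.single i 1) := by
    intro x
    have : x - a = ∑ i, (x i - a i) • EuclideanSpace.single i (1 : ℝ) := by
      ext j
      simp [Finset.sum_apply, Pi.single_apply]
    conv_lhs => rw [this]
    simp [map_sum]
  have hpart : ∀ i : Fin N, ∫ x : 𝔼, (x i - a i) * fderiv ℝ Φ x (EuclideanSpace.single i 1)
      = -∫ x, Φ x := by
    intro i
    have hd : ∀ x : 𝔼, HasFDerivAt (fun x : 𝔼 => x i - a i)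
        (EuclideanSpace.proj i : 𝔼 →L[ℝ] ℝ) x := fun x =>
      ((EuclideanSpace.proj i : 𝔼 →L[ℝ] ℝ).hasFDerivAt).sub_const _
    have hf1 : ∀ x : 𝔼, fderiv ℝ (fun x : 𝔼 => x i - a i) x (EuclideanSpace.single i 1) = 1 := by
      intro x
      rw [(hd x).fderiv]
      simp
    have h := integral_mul_fderiv_eq_neg_fderiv_mul_of_integrable (μ := (volume : Measure 𝔼))
      (f := fun x : 𝔼 => x i - a i) (g := Φ) (v := EuclideanSpace.single i 1)
      (by simpa only [hf1, one_mul] using hΦ.continuous.integrable_of_hasCompactSupport hc)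
      (hint i)
      (Continuous.integrable_of_hasCompactSupport
        (Continuous.mul (by fun_prop) hΦ.continuous) hc.mul_left)
      (fun x _ => (hd x).differentiableAt)
      (fun x _ => hΦ.differentiable one_ne_zero x)
    rw [h]
    simp only [hf1, one_mul]
  simp_rw [hexp]
  rw [integral_finsetSum _ fun i _ => hint i]
  simp [hpart]

/-- Integration by parts against the vector field `g(x) (x - a)`, whose divergence is
`N g(x) + Dg(x)(x - a)`. -/
lemma integral_mul_fderiv_apply_sub {U : Set 𝔼} (hU : IsOpen U) (a : 𝔼) {g φ : 𝔼 → ℝ}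
    (hg : ContDiffOn ℝ 1 g U) (hφ : ContDiff ℝ 1 φ) (hc : HasCompactSupport φ)
    (hs : tsupport φ ⊆ U) :
    ∫ x, g x * fderiv ℝ φ x (x - a) = -∫ x, (N * g x + fderiv ℝ g x (x - a)) * φ x := by
  have hgc : ContinuousOn (fun x => fderiv ℝ g x (x - a)) U :=
    (hg.continuousOn_fderiv_of_isOpen hU le_rfl).clm_apply (by fun_prop)
  have hsf : tsupport (fun x => fderiv ℝ φ x (x - a)) ⊆ tsupport φ := by
    refine closure_minimal ?_ isClosed_closure
    intro x hx
    by_contra hx'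
    have h0 : φ =ᶠ[𝓝 x] fun _ => 0 := notMem_tsupport_iff_eventuallyEq.mp hx'
    apply hx
    simp [h0.fderiv_eq]
  have hφc : Continuous fun x => fderiv ℝ φ x (x - a) :=
    (hφ.continuous_fderiv one_ne_zero).clm_apply (by fun_prop)
  have hsc : HasCompactSupport fun x => fderiv ℝ φ x (x - a) :=
    HasCompactSupport.of_support_subset_isCompact hc ((subset_tsupport _).trans hsf)
  have key := integral_fderiv_apply_sub a (contDiff_mul_of_tsupport_subset hU hg hφ hs) hc.mul_left
  have hprod : ∀ x, fderiv ℝ (fun x => g x * φ x) x (x - a)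
      = g x * fderiv ℝ φ x (x - a) + fderiv ℝ g x (x - a) * φ x := by
    intro x
    by_cases hx : x ∈ tsupport φ
    · rw [fderiv_fun_mul ((hg.contDiffAt (hU.mem_nhds (hs hx))).differentiableAt one_ne_zero)
        (hφ.differentiable one_ne_zero x)]
      simp [mul_comm]
    · have h0 : φ =ᶠ[𝓝 x] fun _ => 0 := notMem_tsupport_iff_eventuallyEq.mp hx
      have h1 : (fun x => g x * φ x) =ᶠ[𝓝 x] fun _ => 0 := by
        filter_upwards [h0] with y hy
        simp [hy]
      rw [h1.fderiv_eq, h0.fderiv_eq, h0.eq_of_nhds]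
      simp
  have i1 := integrable_mul_of_tsupport_subset hU hg.continuousOn hφc hsc (hsf.trans hs)
  have i2 := integrable_mul_of_tsupport_subset hU hgc hφ.continuous hc hs
  have i3 := integrable_mul_of_tsupport_subset hU hg.continuousOn hφ.continuous hc hs
  simp_rw [hprod] at key
  rw [integral_add i1 i2] at key
  have hsum : ∫ x, (N * g x + fderiv ℝ g x (x - a)) * φ x
      = N * (∫ x, g x * φ x) + ∫ x, fderiv ℝ g x (x - a) * φ x := by
    rw [← integral_const_mul, ← integral_add (i3.const_mul _) i2]
    congr 1
    ext x
    ring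
  linarith

/-- If `Δu = h` weakly with `h` continuous, and `u - S` has a local maximum at `x₀`, where
`∇S(x) = g(x) x` with `g` of class `C¹`, then `h(x₀) ≤ ΔS(x₀)`. -/
theorem le_div_of_isLocalMax_sub {U : Set 𝔼} (hU : IsOpen U) {u h S g : 𝔼 → ℝ}
    (hu : ContDiffOn ℝ 1 u U) (hh : ContinuousOn h U)
    (hweak : ∀ φ : 𝔼 → ℝ, ContDiff ℝ 1 φ → HasCompactSupport φ → tsupport φ ⊆ U →
      ∫ x, ⟪gradient u x, gradient φ x⟫ = -∫ x, h x * φ x)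
    (hg : ContDiffOn ℝ 1 g U) (hS : ∀ x ∈ U, HasGradientAt S (g x • x) x)
    {x₀ : 𝔼} (hx₀ : x₀ ∈ U) (hmax : IsLocalMax (fun x => u x - S x) x₀) :
    h x₀ ≤ N * g x₀ + fderiv ℝ g x₀ x₀ := by
  by_contra! hlt
  obtain ⟨ε, hε, hεlt⟩ : ∃ ε > 0, N * g x₀ + fderiv ℝ g x₀ x₀ + 2 * ε * N < h x₀ := by
    refine ⟨(h x₀ - (N * g x₀ + fderiv ℝ g x₀ x₀)) / (2 * (N + 1)), by
      have : (0 : ℝ) < N + 1 := by positivity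
      exact div_pos (by linarith) (by linarith), ?_⟩
    have : (0 : ℝ) < N + 1 := by positivity
    have h1 : 2 * ((h x₀ - (N * g x₀ + fderiv ℝ g x₀ x₀)) / (2 * (N + 1))) * N
        = (h x₀ - (N * g x₀ + fderiv ℝ g x₀ x₀)) * (N / (N + 1)) := by
      field_simp
    have h2 : (N : ℝ) / (N + 1) < 1 := by
      rw [div_lt_one this]
      linarith
    rw [h1]
    nlinarith
  set H : 𝔼 → ℝ := fun x => h x - (N * g x + fderiv ℝ g x x) - 2 * ε * N with hH
  have hgc : ContinuousOn (fun x => fderiv ℝ g x x) U :=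
    (hg.continuousOn_fderiv_of_isOpen hU le_rfl).clm_apply continuousOn_id
  have hHc : ContinuousOn H U :=
    (hh.sub ((continuousOn_const.mul hg.continuousOn).add hgc)).sub continuousOn_const
  have hHpos : ∀ᶠ x in 𝓝 x₀, 0 < H x :=
    (hHc.continuousAt (hU.mem_nhds hx₀)).eventually_const_lt (by simp only [hH]; linarith)
  obtain ⟨r, hr, hball⟩ := Metric.eventually_nhds_iff_ball.mp
    ((hHpos.and hmax).and (hU.mem_nhds hx₀))
  set w : 𝔼 → ℝ := fun x => u x - S x - ε * ‖x - x₀‖ ^ 2 with hw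
  set k : ℝ := u x₀ - S x₀ - ε * (r / 2) ^ 2 with hk
  set φ : 𝔼 → ℝ := (Metric.ball x₀ r).indicator fun x => expNegInvGlue (w x - k) with hφdef
  have hBU : Metric.ball x₀ r ⊆ U := fun x hx => (hball x hx).2
  have hSd : ∀ x ∈ U, HasFDerivAt S (g x • innerSL ℝ x) x := by
    intro x hx
    refine (hS x hx).hasFDerivAt.congr_fderiv ?_
    ext y
    simp
  have hud : ∀ x ∈ U, HasFDerivAt u (fderiv ℝ u x) x := fun x hx =>
    ((hu.contDiffAt (hU.mem_nhds hx)).differentiableAt one_ne_zero).hasFDerivAt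
  have hSc : ContDiffOn ℝ 1 S U := by
    rw [show (1 : WithTop ℕ∞) = 0 + 1 from rfl, contDiffOn_succ_iff_fderiv_of_isOpen hU]
    refine ⟨fun x hx => (hSd x hx).differentiableAt.differentiableWithinAt, by simp, ?_⟩
    rw [contDiffOn_zero]
    have : ContinuousOn (fun x => g x • innerSL ℝ x) U :=
      hg.continuousOn.smul (innerSL ℝ).continuous.continuousOn
    exact this.congr fun x hx => (hSd x hx).fderiv
  have hwc : ContDiffOn ℝ 1 w U := by
    refine (hu.sub hSc).sub (ContDiff.contDiffOn ?_)
    exact contDiff_const.mul ((contDiff_id.sub contDiff_const).norm_sq ℝ)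
  have hwd : ∀ x ∈ U, HasFDerivAt w
      (fderiv ℝ u x - g x • innerSL ℝ x - (2 * ε) • innerSL ℝ (x - x₀)) x := by
    intro x hx
    have hn : HasFDerivAt (fun x : 𝔼 => ‖x - x₀‖ ^ 2) (2 • innerSL ℝ (x - x₀)) x := by
      simpa using ((hasFDerivAt_id x).sub_const x₀).norm_sq
    refine (((hud x hx).sub (hSd x hx)).sub (hn.const_mul ε)).congr_fderiv ?_
    ext y
    simp
    ring
  have hbound : ∀ x ∈ Metric.ball x₀ r, r / 2 < ‖x - x₀‖ → w x - k ≤ 0 := by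
    intro x hx hxr
    have h1 : u x - S x ≤ u x₀ - S x₀ := (hball x hx).1.2
    have h2 : (r / 2) ^ 2 ≤ ‖x - x₀‖ ^ 2 := by gcongr
    simp only [hw, hk]
    nlinarith
  have hzero : ∀ x, r / 2 < ‖x - x₀‖ → φ x = 0 := by
    intro x hx
    by_cases hxb : x ∈ Metric.ball x₀ r
    · simp only [hφdef, Set.indicator_of_mem hxb]
      exact expNegInvGlue.zero_of_nonpos (hbound x hxb hx)
    · simp only [hφdef, Set.indicator_of_notMem hxb]
  have hin : ∀ x ∈ Metric.ball x₀ r, φ =ᶠ[𝓝 x] fun x => expNegInvGlue (w x - k) := by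
    intro x hx
    filter_upwards [Metric.isOpen_ball.mem_nhds hx] with y hy
    simp only [hφdef, Set.indicator_of_mem hy]
  have hφsub : tsupport φ ⊆ Metric.closedBall x₀ (r / 2) := by
    refine closure_minimal ?_ Metric.isClosed_closedBall
    intro x hx
    by_contra hx'
    rw [Metric.mem_closedBall, dist_eq_norm, not_le] at hx'
    exact hx (hzero x hx')
  have hcb : Metric.closedBall x₀ (r / 2) ⊆ Metric.ball x₀ r :=
    Metric.closedBall_subset_ball (by linarith)
  have hφU : tsupport φ ⊆ U := hφsub.trans (hcb.trans hBU)
  have hφcs : HasCompactSupport φ :=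
    HasCompactSupport.of_support_subset_isCompact (isCompact_closedBall x₀ (r / 2))
      ((subset_tsupport φ).trans hφsub)
  have hφ1 : ContDiff ℝ 1 φ := by
    rw [contDiff_iff_contDiffAt]
    intro x
    by_cases hx : x ∈ tsupport φ
    · have hxb := hcb (hφsub hx)
      refine ContDiffAt.congr_of_eventuallyEq ?_ (hin x hxb)
      have h1 : ContDiff ℝ 1 expNegInvGlue := expNegInvGlue.contDiff (n := 1)
      exact h1.contDiffAt.comp x
        ((hwc.contDiffAt (hU.mem_nhds (hBU hxb))).sub contDiffAt_const)
    · exact contDiffAt_const.congr_of_eventuallyEq (notMem_tsupport_iff_eventuallyEq.mp hx)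
  have hφnn : ∀ x, 0 ≤ φ x := fun x =>
    Set.indicator_nonneg (fun y _ => expNegInvGlue.nonneg _) x
  have hφd : ∀ x, 0 ≤ fderiv ℝ u x (gradient φ x) - g x * fderiv ℝ φ x (x - 0)
      - 2 * ε * fderiv ℝ φ x (x - x₀) := by
    intro x
    by_cases hx : x ∈ tsupport φ
    · have hxb := hcb (hφsub hx)
      have hxU := hBU hxb
      have hη : HasDerivAt expNegInvGlue (deriv expNegInvGlue (w x - k)) (w x - k) :=
        ((expNegInvGlue.contDiff (n := 1)).differentiable (by norm_num) _).hasDerivAt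
      have hηnn : 0 ≤ deriv expNegInvGlue (w x - k) := expNegInvGlue.monotone.deriv_nonneg
      have hD := (hη.comp_hasFDerivAt x ((hwd x hxU).sub_const k)).congr_of_eventuallyEq (hin x hxb)
      set D := fderiv ℝ u x - g x • innerSL ℝ x - (2 * ε) • innerSL ℝ (x - x₀) with hDdef
      set G : 𝔼 := gradient u x - g x • x - (2 * ε) • (x - x₀) with hG
      have hDG : ∀ y, D y = ⟪G, y⟫ := by
        intro y
        simp only [hDdef, hG, inner_sub_left, inner_smul_left, inner_gradient_left]
        simp
      have hgr : gradient φ x = deriv expNegInvGlue (w x - k) • G := by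
        apply HasGradientAt.gradient
        rw [hasGradientAt_iff_hasFDerivAt]
        refine hD.congr_fderiv ?_
        ext y
        simp [hDG]
      have hval : fderiv ℝ u x (gradient φ x) - g x * fderiv ℝ φ x (x - 0)
          - 2 * ε * fderiv ℝ φ x (x - x₀) = D (gradient φ x) := by
        rw [← inner_gradient_left (f := φ), ← inner_gradient_left (f := φ)]
        simp only [hDdef, sub_zero, real_inner_comm]
        simp
      rw [hval, hDG, hgr, inner_smul_right]
      exact mul_nonneg hηnn real_inner_self_nonneg
    · have h0 : φ =ᶠ[𝓝 x] fun _ => 0 := notMem_tsupport_iff_eventuallyEq.mp hx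
      simp [gradient, h0.fderiv_eq]
  have e1 := hweak φ hφ1 hφcs hφU
  have e2 := integral_mul_fderiv_apply_sub hU 0 hg hφ1 hφcs hφU
  have e3 := integral_fderiv_apply_sub x₀ hφ1 hφcs
  simp only [inner_gradient_left] at e1
  have hφgc : Continuous (gradient φ) :=
    (InnerProductSpace.toDual ℝ 𝔼).symm.continuous.comp (hφ1.continuous_fderiv one_ne_zero)
  have i1 : Integrable fun x => fderiv ℝ u x (gradient φ x) := by
    have hz : ∀ x ∉ tsupport φ, gradient φ x = 0 := by
      intro x hx
      have h0 : φ =ᶠ[𝓝 x] fun _ => 0 := notMem_tsupport_iff_eventuallyEq.mp hx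
      simp [gradient, h0.fderiv_eq]
    refine Continuous.integrable_of_hasCompactSupport ?_
      (HasCompactSupport.intro hφcs fun x hx => by simp [hz x hx])
    rw [continuous_iff_continuousAt]
    intro x
    by_cases hx : x ∈ tsupport φ
    · exact ((hu.continuousOn_fderiv_of_isOpen hU le_rfl).continuousAt
        (hU.mem_nhds (hφU hx))).clm_apply hφgc.continuousAt
    · have h1 : (fun x => fderiv ℝ u x (gradient φ x)) =ᶠ[𝓝 x] fun _ => 0 := by
        filter_upwards [(isClosed_tsupport φ).isOpen_compl.mem_nhds hx] with y hy
        simp [hz y hy]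
      exact continuousAt_const.congr h1.symm
  have hsupp : ∀ a x, x ∉ tsupport φ → fderiv ℝ φ x (x - a) = 0 := by
    intro a x hx
    have h0 : φ =ᶠ[𝓝 x] fun _ => 0 := notMem_tsupport_iff_eventuallyEq.mp hx
    simp [h0.fderiv_eq]
  have hφdc : ∀ a, Continuous fun x => fderiv ℝ φ x (x - a) := fun a =>
    (hφ1.continuous_fderiv one_ne_zero).clm_apply (by fun_prop)
  have hφds : ∀ a, HasCompactSupport fun x => fderiv ℝ φ x (x - a) := fun a =>
    HasCompactSupport.intro hφcs (hsupp a)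
  have i2 : Integrable fun x => g x * fderiv ℝ φ x (x - 0) := by
    refine integrable_mul_of_tsupport_subset hU hg.continuousOn (hφdc 0) (hφds 0)
      (Set.Subset.trans (closure_minimal (fun x hx => ?_) (isClosed_tsupport φ)) hφU)
    by_contra hx'
    exact hx (hsupp 0 x hx')
  have i3 : Integrable fun x => 2 * ε * fderiv ℝ φ x (x - x₀) :=
    ((hφdc x₀).integrable_of_hasCompactSupport (hφds x₀)).const_mul _
  have hge : 0 ≤ ∫ x, (fderiv ℝ u x (gradient φ x) - g x * fderiv ℝ φ x (x - 0)
      - 2 * ε * fderiv ℝ φ x (x - x₀)) := integral_nonneg hφd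
  have i12 : Integrable fun x => fderiv ℝ u x (gradient φ x) - g x * fderiv ℝ φ x (x - 0) :=
    i1.sub i2
  rw [integral_sub i12 i3, integral_sub i1 i2, integral_const_mul, e1, e2, e3] at hge
  have j1 := integrable_mul_of_tsupport_subset hU hh hφ1.continuous hφcs hφU
  have hdivc : ContinuousOn (fun x => N * g x + fderiv ℝ g x x) U :=
    (continuousOn_const.mul hg.continuousOn).add hgc
  have j2 : Integrable fun x => (N * g x + fderiv ℝ g x (x - 0)) * φ x := by
    simpa only [sub_zero] using
      integrable_mul_of_tsupport_subset hU hdivc hφ1.continuous hφcs hφU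
  have j3 : Integrable fun x => 2 * ε * N * φ x :=
    (hφ1.continuous.integrable_of_hasCompactSupport hφcs).const_mul _
  have hHint : ∫ x, H x * φ x = (∫ x, h x * φ x)
      - (∫ x, (N * g x + fderiv ℝ g x (x - 0)) * φ x) - 2 * ε * N * ∫ x, φ x := by
    have j12 : Integrable fun x => h x * φ x - (N * g x + fderiv ℝ g x (x - 0)) * φ x :=
      j1.sub j2
    rw [← integral_const_mul, ← integral_sub j1 j2, ← integral_sub j12 j3]
    congr 1
    ext x
    simp only [hH, sub_zero]
    ring
  have hHpos' : 0 < ∫ x, H x * φ x := by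
    refine (continuous_mul_of_tsupport_subset hU hHc hφ1.continuous
      hφU).integral_pos_of_hasCompactSupport_nonneg_nonzero (x := x₀) hφcs.mul_left ?_ ?_
    · intro x
      by_cases hx : x ∈ tsupport φ
      · exact mul_nonneg (hball x (hcb (hφsub hx))).1.1.le (hφnn x)
      · simp [image_eq_zero_of_notMem_tsupport hx]
    · have hxb : x₀ ∈ Metric.ball x₀ r := Metric.mem_ball_self hr
      refine mul_ne_zero (hball x₀ hxb).1.1.ne' ?_
      simp only [hφdef, Set.indicator_of_mem hxb]
      refine (expNegInvGlue.pos_of_pos ?_).ne'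
      simp only [hw, hk, sub_self, norm_zero]
      have : 0 < ε * (r / 2) ^ 2 := by positivity
      linarith
  linarith

/-- Counterpart of `le_div_of_isLocalMax_sub` at a local minimum of `u - S`. -/
theorem div_le_of_isLocalMin_sub {U : Set 𝔼} (hU : IsOpen U) {u h S g : 𝔼 → ℝ}
    (hu : ContDiffOn ℝ 1 u U) (hh : ContinuousOn h U)
    (hweak : ∀ φ : 𝔼 → ℝ, ContDiff ℝ 1 φ → HasCompactSupport φ → tsupport φ ⊆ U →
      ∫ x, ⟪gradient u x, gradient φ x⟫ = -∫ x, h x * φ x)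
    (hg : ContDiffOn ℝ 1 g U) (hS : ∀ x ∈ U, HasGradientAt S (g x • x) x)
    {x₀ : 𝔼} (hx₀ : x₀ ∈ U) (hmin : IsLocalMin (fun x => u x - S x) x₀) :
    N * g x₀ + fderiv ℝ g x₀ x₀ ≤ h x₀ := by
  have hgn : ∀ x, gradient (fun x => -u x) x = -gradient u x := by
    intro x
    simp [gradient, fderiv_fun_neg]
  have key := le_div_of_isLocalMax_sub hU (u := fun x => -u x) (h := fun x => -h x)
    (S := fun x => -S x) (g := fun x => -g x) hu.neg hh.neg
    (by
      intro φ h1 h2 h3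
      have := hweak φ h1 h2 h3
      simp only [hgn, inner_neg_left, neg_mul, integral_neg]
      linarith)
    hg.neg
    (by
      intro x hx
      rw [hasGradientAt_iff_hasFDerivAt]
      refine (hS x hx).hasFDerivAt.neg.congr_fderiv ?_
      ext y
      simp)
    hx₀
    (by
      filter_upwards [hmin] with x hx
      linarith)
  rw [fderiv_fun_neg] at key
  simp only [neg_apply, mul_neg] at key
  linarith

end MaximumPrinciple

section RadialTest

variable {N : ℕ}

local notation "𝔼" => EuclideanSpace ℝ (Fin N)

/-- The continuous function `h` for which equation (E) reads `Δu = h`. -/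
def laplRhs (ρ lam τ θ q : ℝ) (u : 𝔼 → ℝ) (x : 𝔼) : ℝ :=
  ((N : ℝ) - 2 + 2 * ρ) * (⟪x, gradient u x⟫ / ‖x‖ ^ 2)
    - lam * Gt τ x (u x) (gradient u x) + ‖x‖ ^ θ * u x ^ q

lemma continuousOn_gradient {U : Set 𝔼} (hU : IsOpen U) {u : 𝔼 → ℝ}
    (hu : ContDiffOn ℝ 1 u U) : ContinuousOn (gradient u) U :=
  (InnerProductSpace.toDual ℝ 𝔼).symm.continuous.comp_continuousOn
    (hu.continuousOn_fderiv_of_isOpen hU le_rfl)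

lemma PosC1.continuousOn_terms {τ θ q : ℝ} (hτ1 : τ < 1)
    {Ω : Set 𝔼} (hΩ : IsOpen Ω) {u : 𝔼 → ℝ} (hu : PosC1 Ω u) :
    ContinuousOn (fun x => ⟪x, gradient u x⟫ / ‖x‖ ^ 2) (Ω \ {0}) ∧
    ContinuousOn (fun x => Gt τ x (u x) (gradient u x)) (Ω \ {0}) ∧
    ContinuousOn (fun x => ‖x‖ ^ θ * u x ^ q) (Ω \ {0}) := by
  have hU : IsOpen (Ω \ {0}) := hΩ.sdiff isClosed_singleton
  have hgc := continuousOn_gradient hU hu.1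
  have huc := hu.1.continuousOn
  have hn : ∀ x ∈ Ω \ {0}, ‖x‖ ≠ 0 := fun x hx => norm_ne_zero_iff.mpr hx.2
  refine ⟨?_, ?_, ?_⟩
  · exact (continuousOn_id.inner hgc).div (by fun_prop) fun x hx => pow_ne_zero 2 (hn x hx)
  · refine ((huc.rpow_const fun x hx => Or.inl (hu.2 x hx).ne').mul
      (hgc.norm.rpow_const fun x hx => Or.inr (by linarith))).div
      (continuous_norm.continuousOn.rpow_const fun x hx => Or.inl (hn x hx)) fun x hx => ?_
    exact (rpow_pos_of_pos (norm_pos_iff.mpr hx.2) _).ne'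
  · exact (continuous_norm.continuousOn.rpow_const fun x hx => Or.inl (hn x hx)).mul
      (huc.rpow_const fun x hx => Or.inl (hu.2 x hx).ne')

lemma PosC1.continuousOn_laplRhs {ρ lam τ θ q : ℝ} (hτ1 : τ < 1)
    {Ω : Set 𝔼} (hΩ : IsOpen Ω) {u : 𝔼 → ℝ} (hu : PosC1 Ω u) :
    ContinuousOn (laplRhs ρ lam τ θ q u) (Ω \ {0}) := by
  obtain ⟨h1, h2, h3⟩ := hu.continuousOn_terms (θ := θ) (q := q) hτ1 hΩ
  exact ((continuousOn_const.mul h1).sub (continuousOn_const.mul h2)).add h3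

/-- A solution of (E) solves `Δu = laplRhs` weakly. -/
lemma IsSolutionE.integral_inner_gradient {ρ lam τ θ q : ℝ} (hτ1 : τ < 1)
    {Ω : Set 𝔼} (hΩ : IsOpen Ω) {u : 𝔼 → ℝ} (hu : IsSolutionE N ρ lam τ θ q Ω u)
    {φ : 𝔼 → ℝ} (hφ : ContDiff ℝ 1 φ) (hc : HasCompactSupport φ) (hs : tsupport φ ⊆ Ω \ {0}) :
    ∫ x, ⟪gradient u x, gradient φ x⟫ = -∫ x, laplRhs ρ lam τ θ q u x * φ x := by
  have hU : IsOpen (Ω \ {0}) := hΩ.sdiff isClosed_singleton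
  obtain ⟨h1, h2, h3⟩ := hu.1.continuousOn_terms (θ := θ) (q := q) hτ1 hΩ
  have i1 := integrable_mul_of_tsupport_subset hU h1 hφ.continuous hc hs
  have i2 := integrable_mul_of_tsupport_subset hU h2 hφ.continuous hc hs
  have i3 := integrable_mul_of_tsupport_subset hU h3 hφ.continuous hc hs
  have hz : ∀ x ∉ Ω \ {0}, φ x = 0 := fun x hx =>
    image_eq_zero_of_notMem_tsupport fun h => hx (hs h)
  have hzg : ∀ x ∉ Ω \ {0}, gradient φ x = 0 := by
    intro x hx
    have h0 : φ =ᶠ[𝓝 x] fun _ => 0 :=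
      notMem_tsupport_iff_eventuallyEq.mp fun h => hx (hs h)
    simp [gradient, h0.fderiv_eq]
  have hE := hu.2 φ ⟨hφ, hc, hs⟩
  unfold weakE at hE
  rw [setIntegral_eq_integral_of_forall_compl_eq_zero
      fun x hx => by rw [hzg x hx, inner_zero_right],
    setIntegral_eq_integral_of_forall_compl_eq_zero fun x hx => by rw [hz x hx, mul_zero],
    setIntegral_eq_integral_of_forall_compl_eq_zero fun x hx => by rw [hz x hx, mul_zero],
    setIntegral_eq_integral_of_forall_compl_eq_zero fun x hx => by rw [hz x hx, mul_zero]] at hE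
  have hsum : ∫ x, laplRhs ρ lam τ θ q u x * φ x
      = ((N : ℝ) - 2 + 2 * ρ) * (∫ x, ⟪x, gradient u x⟫ / ‖x‖ ^ 2 * φ x)
        - lam * (∫ x, Gt τ x (u x) (gradient u x) * φ x) + ∫ x, ‖x‖ ^ θ * u x ^ q * φ x := by
    have i12 : Integrable fun x => ((N : ℝ) - 2 + 2 * ρ) * (⟪x, gradient u x⟫ / ‖x‖ ^ 2 * φ x)
        - lam * (Gt τ x (u x) (gradient u x) * φ x) := (i1.const_mul _).sub (i2.const_mul _)
    rw [← integral_const_mul, ← integral_const_mul,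
      ← integral_sub (i1.const_mul _) (i2.const_mul _), ← integral_add i12 i3]
    congr 1
    ext x
    simp only [laplRhs]
    ring
  linarith

lemma hasFDerivAt_log_norm {x : 𝔼} (hx : x ≠ 0) :
    HasFDerivAt (fun x : 𝔼 => log ‖x‖) ((‖x‖ ^ 2)⁻¹ • innerSL ℝ x) x := by
  have hn : ‖x‖ ≠ 0 := norm_ne_zero_iff.mpr hx
  have h1 : HasFDerivAt (fun x : 𝔼 => ‖x‖ ^ 2) (2 • innerSL ℝ x) x := by
    simpa using (hasFDerivAt_id x).norm_sq
  have h2 := (h1.log (pow_ne_zero 2 hn)).const_mul (1 / 2)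
  have h3 : (fun x : 𝔼 => log ‖x‖) = fun x : 𝔼 => 1 / 2 * log (‖x‖ ^ 2) := by
    ext y
    rw [log_pow]
    push_cast
    ring
  rw [h3]
  refine h2.congr_fderiv ?_
  ext y
  simp
  ring

lemma exp_neg_two_mul_log {r : ℝ} (hr : 0 < r) : exp (-(2 * log r)) = (r ^ 2)⁻¹ := by
  rw [exp_neg, mul_comm, exp_mul, exp_log hr]
  norm_num

/-- The value of `laplRhs` at a point where the gradient of `u` is radial with logarithmic
derivative `P`. -/
lemma laplRhs_of_gradient_eq {ρ lam τ θ q P : ℝ} {u : 𝔼 → ℝ} {x : 𝔼} (hx : x ≠ 0)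
    (hu : 0 < u x) (hgrad : gradient u x = (u x * (‖x‖ ^ 2)⁻¹ * P) • x) :
    laplRhs ρ lam τ θ q u x = u x * (‖x‖ ^ 2)⁻¹ *
      (((N : ℝ) - 2 + 2 * ρ) * P - lam * |P| ^ (1 - τ) + ‖x‖ ^ (θ + 2) * u x ^ (q - 1)) := by
  have hr : 0 < ‖x‖ := norm_pos_iff.mpr hx
  have hnorm : ‖(u x * (‖x‖ ^ 2)⁻¹ * P) • x‖ = u x * ‖x‖⁻¹ * |P| := by
    rw [norm_smul, Real.norm_eq_abs, abs_mul, abs_of_pos (by positivity : 0 < u x * (‖x‖ ^ 2)⁻¹)]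
    field_simp
  have hG : Gt τ x (u x) (gradient u x) = u x * (‖x‖ ^ 2)⁻¹ * |P| ^ (1 - τ) := by
    unfold Gt
    rw [hgrad, hnorm, mul_rpow (by positivity) (abs_nonneg P), mul_rpow hu.le (by positivity),
      inv_rpow hr.le]
    have e1 : u x ^ τ * u x ^ (1 - τ) = u x := by
      rw [← rpow_add hu]
      simp
    have e2 : ‖x‖ ^ (1 - τ) * ‖x‖ ^ (τ + 1) = ‖x‖ ^ 2 := by
      rw [← rpow_add hr, ← rpow_natCast]
      congr 1
      push_cast
      ring
    calc u x ^ τ * (u x ^ (1 - τ) * (‖x‖ ^ (1 - τ))⁻¹ * |P| ^ (1 - τ)) / ‖x‖ ^ (τ + 1)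
        = (u x ^ τ * u x ^ (1 - τ)) * (‖x‖ ^ (1 - τ) * ‖x‖ ^ (τ + 1))⁻¹ * |P| ^ (1 - τ) := by
          rw [mul_inv, div_eq_mul_inv]
          ring
      _ = _ := by rw [e1, e2]
  have hq : ‖x‖ ^ θ * u x ^ q
      = u x * (‖x‖ ^ 2)⁻¹ * (‖x‖ ^ (θ + 2) * u x ^ (q - 1)) := by
    have e1 : ‖x‖ ^ (θ + 2) = ‖x‖ ^ θ * ‖x‖ ^ 2 := by
      rw [rpow_add hr]
      norm_num
    have e2 : u x ^ q = u x ^ (q - 1) * u x := by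
      rw [rpow_sub_one hu.ne']
      field_simp
    rw [e1, e2]
    field_simp
  unfold laplRhs
  rw [hG, hq, hgrad, inner_smul_right, real_inner_self_eq_norm_sq]
  field_simp

/-- At a point where `log u - ψ(log‖x‖)` is extremal, equation (E) becomes a one-sided ordinary
differential inequality for `ψ`. -/
theorem IsSolutionE.radial_test {ρ lam τ θ q : ℝ} (hτ1 : τ < 1)
    {Ω : Set 𝔼} (hΩ : IsOpen Ω) {u : 𝔼 → ℝ} (hu : IsSolutionE N ρ lam τ θ q Ω u)
    {x₀ : 𝔼} (hx₀ : x₀ ∈ Ω \ {0}) {ψ ψ₁ : ℝ → ℝ} {ψ₂ : ℝ}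
    (hψ : ∀ᶠ t in 𝓝 (log ‖x₀‖), HasDerivAt ψ (ψ₁ t) t)
    (hψ₁ : ContDiffAt ℝ 1 ψ₁ (log ‖x₀‖)) (hψ₂ : HasDerivAt ψ₁ ψ₂ (log ‖x₀‖)) :
    (IsLocalMax (fun x => log (u x) - ψ (log ‖x‖)) x₀ →
      ‖x₀‖ ^ (θ + 2) * u x₀ ^ (q - 1) ≤ fRho ρ lam τ (-ψ₁ (log ‖x₀‖)) + ψ₂) ∧
    (IsLocalMin (fun x => log (u x) - ψ (log ‖x‖)) x₀ →
      fRho ρ lam τ (-ψ₁ (log ‖x₀‖)) + ψ₂ ≤ ‖x₀‖ ^ (θ + 2) * u x₀ ^ (q - 1)) := by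
  have hU : IsOpen (Ω \ {0}) := hΩ.sdiff isClosed_singleton
  have hux₀ : 0 < u x₀ := hu.1.2 x₀ hx₀
  have hr₀ : 0 < ‖x₀‖ := norm_pos_iff.mpr hx₀.2
  set t₀ := log ‖x₀‖ with ht₀
  set c : ℝ := log (u x₀) - ψ t₀ with hc
  obtain ⟨J, hJ, hJo, ht₀J⟩ := mem_nhds_iff.mp
    (hψ.and (hψ₁.eventually (by simp)))
  set S : 𝔼 → ℝ := fun x => exp (c + ψ (log ‖x‖)) with hSdef
  set γ : ℝ → ℝ := fun t => exp (c + ψ t - 2 * t) * ψ₁ t with hγ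
  set g : 𝔼 → ℝ := fun x => γ (log ‖x‖) with hgdef
  set V : Set 𝔼 := (Ω \ {0}) ∩ (fun x => log ‖x‖) ⁻¹' J with hV
  have hlogc : ContinuousOn (fun x : 𝔼 => log ‖x‖) (Ω \ {0}) := fun x hx =>
    (hasFDerivAt_log_norm hx.2).continuousAt.continuousWithinAt
  have hVo : IsOpen V := hlogc.isOpen_inter_preimage hU hJo
  have hVU : V ⊆ Ω \ {0} := Set.inter_subset_left
  have hx₀V : x₀ ∈ V := ⟨hx₀, ht₀J⟩
  have hψc : ContDiffOn ℝ 1 ψ J := by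
    rw [show (1 : WithTop ℕ∞) = 0 + 1 from rfl, contDiffOn_succ_iff_deriv_of_isOpen hJo]
    refine ⟨fun t ht => (hJ ht).1.differentiableAt.differentiableWithinAt, by simp, ?_⟩
    rw [contDiffOn_zero]
    have : ContinuousOn ψ₁ J := fun t ht => (hJ ht).2.continuousAt.continuousWithinAt
    exact this.congr fun t ht => (hJ ht).1.deriv
  have hγc : ContDiffOn ℝ 1 γ J :=
    (((contDiffOn_const.add hψc).sub (by fun_prop)).exp).mul
      fun t ht => (hJ ht).2.contDiffWithinAt
  have hlogd : ContDiffOn ℝ 1 (fun x : 𝔼 => log ‖x‖) V := fun x hx =>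
    (((contDiffAt_norm ℝ (hVU hx).2).log (norm_ne_zero_iff.mpr (hVU hx).2))).contDiffWithinAt
  have hgc : ContDiffOn ℝ 1 g V := hγc.comp hlogd fun x hx => hx.2
  have hS : ∀ x ∈ V, HasGradientAt S (g x • x) x := by
    intro x hx
    rw [hasGradientAt_iff_hasFDerivAt]
    have h1 := ((hJ hx.2).1.const_add c).exp.comp_hasFDerivAt x (hasFDerivAt_log_norm (hVU hx).2)
    refine h1.congr_fderiv ?_
    ext y
    have h2 : exp (c + ψ (log ‖x‖) - 2 * log ‖x‖)
        = exp (c + ψ (log ‖x‖)) * (‖x‖ ^ 2)⁻¹ := by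
      rw [sub_eq_add_neg, exp_add, exp_neg_two_mul_log (norm_pos_iff.mpr (hVU hx).2)]
    simp [hgdef, hγ, h2]
    ring
  have hSx₀ : S x₀ = u x₀ := by
    simp only [hSdef, hc, ← ht₀]
    rw [sub_add_cancel, exp_log hux₀]
  have hexp : exp (c + ψ t₀ - 2 * t₀) = u x₀ * (‖x₀‖ ^ 2)⁻¹ := by
    rw [sub_eq_add_neg, exp_add, exp_neg_two_mul_log hr₀, hc, sub_add_cancel, exp_log hux₀]
  have hgx₀ : g x₀ = u x₀ * (‖x₀‖ ^ 2)⁻¹ * ψ₁ t₀ := by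
    simp only [hgdef, hγ, ← ht₀, hexp]
  have hγd : HasDerivAt γ (u x₀ * (‖x₀‖ ^ 2)⁻¹ * ((ψ₁ t₀ - 2) * ψ₁ t₀ + ψ₂)) t₀ := by
    have h1 : HasDerivAt (fun t => c + ψ t - 2 * t) (ψ₁ t₀ - 2) t₀ := by
      exact (((hJ ht₀J).1.const_add c).sub ((hasDerivAt_id t₀).const_mul 2)).congr_deriv (by simp)
    refine (h1.exp.mul hψ₂).congr_deriv ?_
    rw [hexp]
    ring
  have hgd : fderiv ℝ g x₀ x₀ = u x₀ * (‖x₀‖ ^ 2)⁻¹ * ((ψ₁ t₀ - 2) * ψ₁ t₀ + ψ₂) := by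
    have hgf := HasDerivAt.comp_hasFDerivAt (f := fun x : 𝔼 => log ‖x‖) x₀ hγd
      (hasFDerivAt_log_norm hx₀.2)
    rw [show g = γ ∘ fun x : 𝔼 => log ‖x‖ from rfl, hgf.fderiv]
    have : ‖x₀‖ ≠ 0 := hr₀.ne'
    simp
    field_simp
  have huV : ContDiffOn ℝ 1 u V := hu.1.1.mono hVU
  have hhV := (hu.1.continuousOn_laplRhs (ρ := ρ) (lam := lam) (θ := θ) (q := q)
    hτ1 hΩ).mono hVU
  have hweak : ∀ φ : 𝔼 → ℝ, ContDiff ℝ 1 φ → HasCompactSupport φ → tsupport φ ⊆ V →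
      ∫ x, ⟪gradient u x, gradient φ x⟫ = -∫ x, laplRhs ρ lam τ θ q u x * φ x :=
    fun φ h1 h2 h3 => hu.integral_inner_gradient hτ1 hΩ h1 h2 (h3.trans hVU)
  have hudiff : DifferentiableAt ℝ u x₀ :=
    (huV.contDiffAt (hVo.mem_nhds hx₀V)).differentiableAt one_ne_zero
  have hgrad : IsLocalExtr (fun x => u x - S x) x₀ →
      gradient u x₀ = (u x₀ * (‖x₀‖ ^ 2)⁻¹ * ψ₁ t₀) • x₀ := by
    intro hext
    have h1 := hext.fderiv_eq_zero
    rw [fderiv_fun_sub hudiff (hS x₀ hx₀V).differentiableAt, sub_eq_zero] at h1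
    rw [← hgx₀, ← (hS x₀ hx₀V).gradient, gradient, gradient, h1]
  have hapos : 0 < u x₀ * (‖x₀‖ ^ 2)⁻¹ := by positivity
  have hfR : fRho ρ lam τ (-ψ₁ t₀) = ψ₁ t₀ ^ 2 - 2 * ρ * ψ₁ t₀ + lam * |ψ₁ t₀| ^ (1 - τ) := by
    unfold fRho
    rw [abs_neg]
    ring
  have hdiv : N * g x₀ + fderiv ℝ g x₀ x₀
      = u x₀ * (‖x₀‖ ^ 2)⁻¹ * (N * ψ₁ t₀ + ((ψ₁ t₀ - 2) * ψ₁ t₀ + ψ₂)) := by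
    rw [hgx₀, hgd]
    ring
  constructor
  · intro hmax
    have hloc : IsLocalMax (fun x => u x - S x) x₀ := by
      filter_upwards [hmax, hVo.mem_nhds hx₀V] with x hx hxV
      have h1 : log (u x) ≤ c + ψ (log ‖x‖) := by
        simp only [hc]
        linarith
      have h2 : u x ≤ S x := (log_le_iff_le_exp (hu.1.2 x (hVU hxV))).mp h1
      linarith
    have key := le_div_of_isLocalMax_sub hVo huV hhV hweak hgc hS hx₀V hloc
    rw [laplRhs_of_gradient_eq hx₀.2 hux₀ (hgrad (Or.inr hloc)), hdiv] at key
    have key' := le_of_mul_le_mul_left key hapos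
    rw [hfR]
    linarith
  · intro hmin
    have hloc : IsLocalMin (fun x => u x - S x) x₀ := by
      filter_upwards [hmin, hVo.mem_nhds hx₀V] with x hx hxV
      have h1 : c + ψ (log ‖x‖) ≤ log (u x) := by
        simp only [hc]
        linarith
      have h2 : S x ≤ u x := (le_log_iff_exp_le (hu.1.2 x (hVU hxV))).mp h1
      linarith
    have key := div_le_of_isLocalMin_sub hVo huV hhV hweak hgc hS hx₀V hloc
    rw [laplRhs_of_gradient_eq hx₀.2 hux₀ (hgrad (Or.inl hloc)), hdiv] at key
    have key' := le_of_mul_le_mul_left key hapos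
    rw [hfR]
    linarith

end RadialTest

section IndicialFunction

/-- Second-order Taylor bound for `|x|^σ` at `1`, uniform over the real line. -/
lemma abs_abs_rpow_sub_le {τ : ℝ} (hτ0 : 0 ≤ τ) (hτ1 : τ < 1) (x : ℝ) :
    |(|x| ^ (1 - τ) - 1 - (1 - τ) * (x - 1))| ≤ 2 * (x - 1) ^ 2 := by
  have upper : ∀ y : ℝ, 0 ≤ y → y ^ (1 - τ) ≤ 1 + (1 - τ) * (y - 1) := by
    intro y hy
    have := rpow_one_add_le_one_add_mul_self (s := y - 1) (by linarith)
      (p := 1 - τ) (by linarith) (by linarith)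
    simpa using this
  rw [abs_le]
  rcases lt_trichotomy x 0 with hx | rfl | hx
  · have h1 := upper |x| (abs_nonneg x)
    have h2 : 0 ≤ |x| ^ (1 - τ) := by positivity
    rw [abs_of_neg hx] at h1 h2 ⊢
    constructor <;> nlinarith
  · rw [abs_zero, zero_rpow (by linarith)]
    constructor <;> linarith
  · rw [abs_of_pos hx]
    refine ⟨?_, by nlinarith [upper x hx.le]⟩
    have h1 : x ^ τ ≤ 1 + τ * (x - 1) := by
      simpa using rpow_one_add_le_one_add_mul_self (s := x - 1) (by linarith) hτ0 hτ1.le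
    have h2 : x = x ^ (1 - τ) * x ^ τ := by
      rw [← rpow_add hx]
      simp
    have h3 : 0 < x ^ (1 - τ) := rpow_pos_of_pos hx _
    have h4 : x ≤ x ^ (1 - τ) * (1 + τ * (x - 1)) :=
      h2.le.trans (mul_le_mul_of_nonneg_left h1 h3.le)
    have h5 : 0 < 1 + τ * (x - 1) := by nlinarith
    have h6 : (1 + (1 - τ) * (x - 1) - 2 * (x - 1) ^ 2) * (1 + τ * (x - 1)) ≤ x := by
      have : (1 - τ) * τ - 2 - 2 * τ * (x - 1) ≤ 0 := by nlinarith [mul_nonneg hτ0 hx.le]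
      nlinarith [mul_nonneg (sq_nonneg (x - 1)) (neg_nonneg.mpr this)]
    have := le_of_mul_le_mul_right (h6.trans h4) h5
    linarith

variable {ρ lam τ m : ℝ}

lemma rpow_one_sub_eq (hm : 0 < m) : m ^ (1 - τ) = m ^ (-τ - 1) * m ^ 2 := by
  rw [← rpow_natCast, ← rpow_add hm]
  congr 1
  push_cast
  ring

/-- First-order expansion of `f_ρ` at its root `-m`. -/
lemma abs_fRho_sub_le (hτ0 : 0 ≤ τ) (hτ1 : τ < 1) (hm : 0 < m)
    (hroot : fRho ρ lam τ (-m) = 0) (p : ℝ) :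
    |fRho ρ lam τ (-(m + p)) - m * (1 - lam * τ * m ^ (-τ - 1)) * p|
      ≤ (1 + 2 * |lam| * m ^ (-τ - 1)) * p ^ 2 := by
  have hQ : 0 < m ^ (-τ - 1) := rpow_pos_of_pos hm _
  have hR := abs_abs_rpow_sub_le hτ0 hτ1 (1 + p / m)
  set R := |1 + p / m| ^ (1 - τ) - 1 - (1 - τ) * (1 + p / m - 1) with hRdef
  have hsplit : |m + p| ^ (1 - τ) = m ^ (-τ - 1) * m ^ 2 * (1 + (1 - τ) * (p / m) + R) := by
    have : m + p = m * (1 + p / m) := by field_simp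
    rw [this, abs_mul, abs_of_pos hm, mul_rpow hm.le (abs_nonneg _), rpow_one_sub_eq hm, hRdef]
    ring
  unfold fRho at hroot ⊢
  rw [abs_neg, abs_of_pos hm, rpow_one_sub_eq hm] at hroot
  rw [abs_neg, hsplit]
  set Q := m ^ (-τ - 1)
  have hρ : 2 * ρ = m + lam * Q * m := by
    have : m * (m + lam * Q * m - 2 * ρ) = 0 := by linarith
    rcases mul_eq_zero.mp this with h | h <;> linarith
  have e : -(m + p) * (-(m + p) + 2 * ρ) + lam * (Q * m ^ 2 * (1 + (1 - τ) * (p / m) + R))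
      - m * (1 - lam * τ * Q) * p = p ^ 2 + lam * Q * m ^ 2 * R := by
    rw [hρ]
    field_simp
    ring
  rw [e]
  have hb : m ^ 2 * |R| ≤ 2 * p ^ 2 := by
    calc m ^ 2 * |R| ≤ m ^ 2 * (2 * (1 + p / m - 1) ^ 2) := by gcongr
      _ = 2 * p ^ 2 := by field_simp; ring
  calc |p ^ 2 + lam * Q * m ^ 2 * R| ≤ |p ^ 2| + |lam * Q * m ^ 2 * R| := abs_add_le _ _
    _ = p ^ 2 + |lam| * Q * (m ^ 2 * |R|) := by
      rw [abs_mul, abs_mul, abs_mul, abs_of_pos hQ, abs_of_nonneg (sq_nonneg p),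
        abs_of_nonneg (sq_nonneg m)]
      ring
    _ ≤ p ^ 2 + |lam| * Q * (2 * p ^ 2) := by gcongr
    _ = _ := by ring

/-- The smallest negative root of `f_ρ` is simple. -/
lemma IsMinNegRoot.slope_pos (hτ0 : 0 ≤ τ)
    (hcase : CaseN1 ρ lam τ ∨ (CaseN2 ρ lam τ ∧ ρ ≠ Upsilon lam τ)) (hm : 0 < m)
    (hroot : IsMinNegRoot ρ lam τ (-m)) : 0 < 1 - lam * τ * m ^ (-τ - 1) := by
  have hQ : 0 < m ^ (-τ - 1) := rpow_pos_of_pos hm _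
  rcases hcase with (⟨rfl, -⟩ | ⟨hl, hτ, -⟩) | ⟨⟨hl, hτ, hτ1, hΥ⟩, hne⟩
  · simp
  · nlinarith [mul_pos (mul_pos (neg_pos.mpr hl) hτ) hQ]
  have hlt : lam * τ > 0 := mul_pos hl hτ
  set P := (lam * τ) ^ (1 / (τ + 1)) with hP
  have hPpos : 0 < P := rpow_pos_of_pos hlt _
  have hPpow : P ^ (τ + 1) = lam * τ := by
    rw [hP, ← rpow_mul hlt.le, one_div_mul_cancel (by linarith), rpow_one]
  have hlP : lam * P ^ (1 - τ) = P ^ 2 / τ := by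
    have h1 : P ^ (1 - τ) * P ^ (τ + 1) = P ^ 2 := by
      rw [← rpow_add hPpos, ← rpow_natCast]
      congr 1
      push_cast
      ring
    rw [hPpow] at h1
    rw [← h1]
    field_simp
  have hneg : fRho ρ lam τ (-P) < 0 := by
    have h1 : Upsilon lam τ < ρ := lt_of_le_of_ne hΥ hne.symm
    have h2 : Upsilon lam τ = (τ + 1) / (2 * τ) * P := rfl
    have h3 : fRho ρ lam τ (-P) = 2 * P * (Upsilon lam τ - ρ) := by
      unfold fRho
      rw [abs_neg, abs_of_pos hPpos, hlP, h2]
      field_simp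
      ring
    rw [h3]
    exact mul_neg_of_pos_of_neg (by positivity) (by linarith)
  set M := max P (2 * ρ) with hM
  have hMP : P ≤ M := le_max_left _ _
  have hpos : 0 ≤ fRho ρ lam τ (-M) := by
    have h1 : 2 * ρ ≤ M := le_max_right _ _
    have h2 : 0 ≤ lam * |-M| ^ (1 - τ) := by positivity
    have h3 : 0 ≤ M * (M - 2 * ρ) := mul_nonneg (by linarith) (by linarith)
    unfold fRho
    linarith
  have hcont : ContinuousOn (fun s => fRho ρ lam τ (-s)) (Set.Icc P M) := by
    unfold fRho
    refine ContinuousOn.add (by fun_prop) (continuousOn_const.mul ?_)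
    exact (by fun_prop : ContinuousOn (fun s : ℝ => |-s|) (Set.Icc P M)).rpow_const
      fun s _ => Or.inr (by linarith)
  obtain ⟨s, ⟨hs1, -⟩, hs0⟩ := intermediate_value_Icc hMP hcont ⟨hneg.le, hpos⟩
  have hsP : P < s := by
    refine lt_of_le_of_ne hs1 ?_
    rintro rfl
    exact hneg.ne hs0
  have hPm : P < m := by linarith [hroot.2.2 (-s) (by linarith) hs0]
  have h1 : lam * τ < m ^ (τ + 1) := by
    rw [← hPpow]
    exact rpow_lt_rpow hPpos.le hPm (by linarith)
  have h2 : m ^ (τ + 1) * m ^ (-τ - 1) = 1 := by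
    rw [← rpow_add hm]
    simp
  nlinarith

/-- Quadratic growth of `f_ρ` to the left of its simple root `-m`. -/
lemma exists_le_fRho (hτ0 : 0 ≤ τ) (hτ1 : τ < 1) (hm : 0 < m) (hroot : fRho ρ lam τ (-m) = 0)
    (ha : 0 < 1 - lam * τ * m ^ (-τ - 1)) :
    ∃ c > 0, ∀ p, 0 ≤ p → c * (p + p ^ 2) ≤ fRho ρ lam τ (-(m + p)) := by
  set a := 1 - lam * τ * m ^ (-τ - 1) with hadef
  refine ⟨min 1 a * min m 1, by positivity, fun p hp => ?_⟩
  have hP : 0 < m + p := by linarith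
  have hg : ∀ s : ℝ, 0 < s → fRho ρ lam τ (-s) = s * (s - 2 * ρ + lam * s ^ (-τ)) := by
    intro s hs
    unfold fRho
    rw [abs_neg, abs_of_pos hs, sub_eq_neg_add, rpow_add_one hs.ne']
    ring
  have hρ : m - 2 * ρ + lam * m ^ (-τ) = 0 := by
    rw [hg m hm] at hroot
    exact (mul_eq_zero.mp hroot).resolve_left hm.ne'
  have hslope : min 1 a * p ≤ (m + p) - 2 * ρ + lam * (m + p) ^ (-τ) := by
    rcases le_total lam 0 with hl | hl
    · have h1 : (m + p) ^ (-τ) ≤ m ^ (-τ) :=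
        rpow_le_rpow_of_nonpos hm (by linarith) (by linarith)
      have h2 : min 1 a * p ≤ 1 * p := by gcongr; exact min_le_left _ _
      nlinarith
    · have h1 : m ^ (-τ) - τ * m ^ (-τ - 1) * p ≤ (m + p) ^ (-τ) := by
        have hx : 0 ≤ p / m := by positivity
        have hb : 1 + -τ * (p / m) ≤ (1 + p / m) ^ (-τ) := by
          have hb' : (1 + p / m) ^ τ ≤ 1 + τ * (p / m) :=
            rpow_one_add_le_one_add_mul_self (by linarith) hτ0 hτ1.le
          have hpos : 0 < (1 + p / m) ^ τ := by positivity
          rw [rpow_neg (by positivity), ← one_div, le_div_iff₀ hpos]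
          rcases le_total (1 + -τ * (p / m)) 0 with h | h
          · nlinarith
          · nlinarith [mul_nonneg hτ0 hx]
        have e1 : (m + p) ^ (-τ) = m ^ (-τ) * (1 + p / m) ^ (-τ) := by
          rw [← mul_rpow hm.le (by positivity)]
          congr 1
          field_simp
        have e2 : m ^ (-τ - 1) = m ^ (-τ) / m := rpow_sub_one hm.ne' _
        rw [e1, e2]
        calc m ^ (-τ) - τ * (m ^ (-τ) / m) * p = m ^ (-τ) * (1 + -τ * (p / m)) := by
              field_simp
              ring
          _ ≤ _ := by gcongr
      have h2 : min 1 a * p ≤ a * p := by gcongr; exact min_le_right _ _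
      have h3 := mul_le_mul_of_nonneg_left h1 hl
      have h4 : a * p = p - lam * (τ * m ^ (-τ - 1) * p) := by rw [hadef]; ring
      nlinarith
  rw [hg _ hP]
  have h1 : min m 1 * (1 + p) ≤ m + p := by
    have := min_le_left m 1
    have := min_le_right m 1
    nlinarith
  calc min 1 a * min m 1 * (p + p ^ 2) = (min m 1 * (1 + p)) * (min 1 a * p) := by ring
    _ ≤ (m + p) * (min 1 a * p) := by gcongr
    _ ≤ _ := by gcongr

end IndicialFunction

section LogarithmicBarriers

variable {N : ℕ}

local notation "𝔼" => EuclideanSpace ℝ (Fin N)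

/-- `IsSolutionE.radial_test` for `ψ(t) = m t + c₁ log(a₁-t) + c₂ log(a₂-t) + c₃ log(t-a₃)`. -/
lemma IsSolutionE.log_barrier_test {ρ lam τ θ q : ℝ} (hτ1 : τ < 1)
    {Ω : Set 𝔼} (hΩ : IsOpen Ω) {u : 𝔼 → ℝ} (hu : IsSolutionE N ρ lam τ θ q Ω u)
    {x₀ : 𝔼} (hx₀ : x₀ ∈ Ω \ {0}) (m c₁ c₂ c₃ : ℝ) {a₁ a₂ a₃ t : ℝ} (ht : log ‖x₀‖ = t)
    (h₁ : t < a₁) (h₂ : t < a₂) (h₃ : a₃ < t) :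
    (IsLocalMax (fun x => log (u x) - (m * log ‖x‖ + c₁ * log (a₁ - log ‖x‖)
        + c₂ * log (a₂ - log ‖x‖) + c₃ * log (log ‖x‖ - a₃))) x₀ →
      ‖x₀‖ ^ (θ + 2) * u x₀ ^ (q - 1) ≤
        fRho ρ lam τ (-(m + (-c₁ / (a₁ - t) - c₂ / (a₂ - t) + c₃ / (t - a₃))))
          + (-c₁ / (a₁ - t) ^ 2 - c₂ / (a₂ - t) ^ 2 - c₃ / (t - a₃) ^ 2)) ∧
    (IsLocalMin (fun x => log (u x) - (m * log ‖x‖ + c₁ * log (a₁ - log ‖x‖)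
        + c₂ * log (a₂ - log ‖x‖) + c₃ * log (log ‖x‖ - a₃))) x₀ →
      fRho ρ lam τ (-(m + (-c₁ / (a₁ - t) - c₂ / (a₂ - t) + c₃ / (t - a₃))))
          + (-c₁ / (a₁ - t) ^ 2 - c₂ / (a₂ - t) ^ 2 - c₃ / (t - a₃) ^ 2)
        ≤ ‖x₀‖ ^ (θ + 2) * u x₀ ^ (q - 1)) := by
  subst ht
  have hd : ∀ (a s : ℝ), HasDerivAt (fun s => a - s) (-1) s := fun a s => by
    simpa using (hasDerivAt_id s).const_sub a
  have hd' : ∀ (a s : ℝ), HasDerivAt (fun s => s - a) 1 s := fun a s => by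
    simpa using (hasDerivAt_id s).sub_const a
  refine hu.radial_test hτ1 hΩ hx₀
    (ψ := fun s => m * s + c₁ * log (a₁ - s) + c₂ * log (a₂ - s) + c₃ * log (s - a₃))
    (ψ₁ := fun s => m + (-c₁ / (a₁ - s) - c₂ / (a₂ - s) + c₃ / (s - a₃))) ?_ ?_ ?_
  · filter_upwards [Iio_mem_nhds h₁, Iio_mem_nhds h₂, Ioi_mem_nhds h₃] with s hs₁ hs₂ hs₃
    have k₁ : a₁ - s ≠ 0 := (sub_pos.mpr hs₁).ne'
    have k₂ : a₂ - s ≠ 0 := (sub_pos.mpr hs₂).ne'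
    have k₃ : s - a₃ ≠ 0 := (sub_pos.mpr hs₃).ne'
    refine (((((hasDerivAt_id s).const_mul m).add (((hd a₁ s).log k₁).const_mul c₁)).add
      (((hd a₂ s).log k₂).const_mul c₂)).add (((hd' a₃ s).log k₃).const_mul c₃)).congr_deriv ?_
    field_simp
    ring
  · have k₁ : a₁ - log ‖x₀‖ ≠ 0 := (sub_pos.mpr h₁).ne'
    have k₂ : a₂ - log ‖x₀‖ ≠ 0 := (sub_pos.mpr h₂).ne'
    have k₃ : log ‖x₀‖ - a₃ ≠ 0 := (sub_pos.mpr h₃).ne'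
    fun_prop (disch := assumption)
  · have k₁ : a₁ - log ‖x₀‖ ≠ 0 := (sub_pos.mpr h₁).ne'
    have k₂ : a₂ - log ‖x₀‖ ≠ 0 := (sub_pos.mpr h₂).ne'
    have k₃ : log ‖x₀‖ - a₃ ≠ 0 := (sub_pos.mpr h₃).ne'
    refine (((((hasDerivAt_const _ (-c₁)).div (hd a₁ _) k₁).sub
      ((hasDerivAt_const _ c₂).div (hd a₂ _) k₂)).add
      ((hasDerivAt_const _ c₃).div (hd' a₃ _) k₃)).const_add m).congr_deriv ?_
    ring

/-- A function on a closed annulus whose value at some point exceeds its boundary values has an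
interior local maximum. -/
lemma exists_isLocalMax_annulus {V : 𝔼 → ℝ} {b t : ℝ}
    (hV : ContinuousOn V (Metric.closedBall 0 (exp t) \ {0})) {x : 𝔼} (hx : x ≠ 0)
    (hbx : b < log ‖x‖) (hxt : log ‖x‖ < t)
    (hbd : ∀ y : 𝔼, y ≠ 0 → log ‖y‖ = b ∨ log ‖y‖ = t → V y < V x) :
    ∃ x₀ : 𝔼, x₀ ≠ 0 ∧ b < log ‖x₀‖ ∧ log ‖x₀‖ < t ∧ V x ≤ V x₀ ∧ IsLocalMax V x₀ := by
  set K : Set 𝔼 := Metric.closedBall 0 (exp t) \ Metric.ball 0 (exp b) with hK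
  have hKc : IsCompact K := (isCompact_closedBall _ _).diff Metric.isOpen_ball
  have hmem : ∀ y : 𝔼, y ∈ K ↔ y ≠ 0 ∧ b ≤ log ‖y‖ ∧ log ‖y‖ ≤ t := by
    intro y
    by_cases hy : y = 0
    · simp [hK, hy, exp_pos]
    · have hn : 0 < ‖y‖ := norm_pos_iff.mpr hy
      simp [hK, hy, log_le_iff_le_exp hn, le_log_iff_exp_le hn, and_comm]
  have hKs : K ⊆ Metric.closedBall 0 (exp t) \ {0} := fun y hy =>
    ⟨hy.1, ((hmem y).mp hy).1⟩
  obtain ⟨x₀, hx₀, hmax⟩ := hKc.exists_isMaxOn ⟨x, (hmem x).mpr ⟨hx, hbx.le, hxt.le⟩⟩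
    (hV.mono hKs)
  have hle : V x ≤ V x₀ := hmax ((hmem x).mpr ⟨hx, hbx.le, hxt.le⟩)
  obtain ⟨h0, hb, ht⟩ := (hmem x₀).mp hx₀
  have hb' : b < log ‖x₀‖ := lt_of_le_of_ne hb fun h => (hbd x₀ h0 (Or.inl h.symm)).not_ge hle
  have ht' : log ‖x₀‖ < t := lt_of_le_of_ne ht fun h => (hbd x₀ h0 (Or.inr h)).not_ge hle
  refine ⟨x₀, h0, hb', ht', hle, ?_⟩
  have hc : ContinuousAt (fun x : 𝔼 => log ‖x‖) x₀ := (hasFDerivAt_log_norm h0).continuousAt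
  filter_upwards [hc.eventually (lt_mem_nhds hb'), hc.eventually (gt_mem_nhds ht'),
    isOpen_ne.mem_nhds h0] with y hy1 hy2 hy3
  exact hmax ((hmem y).mpr ⟨hy3, hy1.le, hy2.le⟩)

/-- The scale-invariant quantity `|x|^(θ+2) u^(q-1)`. -/
def scaled (θ q : ℝ) (u : 𝔼 → ℝ) (x : 𝔼) : ℝ := ‖x‖ ^ (θ + 2) * u x ^ (q - 1)

lemma scaled_pos {θ q : ℝ} {Ω : Set 𝔼} {u : 𝔼 → ℝ} (hu : PosC1 Ω u) {x : 𝔼}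
    (hx : x ∈ Ω \ {0}) : 0 < scaled θ q u x :=
  mul_pos (rpow_pos_of_pos (norm_pos_iff.mpr hx.2) _) (rpow_pos_of_pos (hu.2 x hx) _)

lemma continuousOn_scaled {θ q : ℝ} {Ω : Set 𝔼} {u : 𝔼 → ℝ} (hu : PosC1 Ω u) :
    ContinuousOn (scaled θ q u) (Ω \ {0}) :=
  (continuous_norm.continuousOn.rpow_const fun _ hx => Or.inl (norm_ne_zero_iff.mpr hx.2)).mul
    (hu.1.continuousOn.rpow_const fun x hx => Or.inl (hu.2 x hx).ne')

lemma log_scaled {θ q m : ℝ} (hm : θ + 2 = -m * (q - 1)) {Ω : Set 𝔼} {u : 𝔼 → ℝ}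
    (hu : PosC1 Ω u) {x : 𝔼} (hx : x ∈ Ω \ {0}) :
    log (scaled θ q u x) = (q - 1) * (log (u x) - m * log ‖x‖) := by
  have hn : 0 < ‖x‖ := norm_pos_iff.mpr hx.2
  have hux := hu.2 x hx
  rw [scaled, log_mul (rpow_pos_of_pos hn _).ne' (rpow_pos_of_pos hux _).ne', log_rpow hn,
    log_rpow hux, hm]
  ring

end LogarithmicBarriers

section Bounds

variable {N : ℕ}

local notation "𝔼" => EuclideanSpace ℝ (Fin N)

lemma upper_barrier_estimate {y L B κ A C : ℝ} (hy : 0 < y) (hyL : y < L) (hB : 0 < B)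
    (hκ : 0 < κ) (hA : 0 < A) (hC : 0 ≤ C) :
    (A * (κ * (2 / y - 1 / (y + B) - 2 / (L - y)))
        + C * (κ * (2 / y - 1 / (y + B) - 2 / (L - y))) ^ 2
        + κ * (2 / y ^ 2 - 1 / (y + B) ^ 2 + 2 / (L - y) ^ 2))
      * (y ^ 2 / (y + B) * (1 - y / L) ^ 2)
      ≤ A * κ + (8 * C * κ ^ 2 + 2 * κ) * (1 / B + 1 / L) := by
  have hL : 0 < L := hy.trans hyL
  have hyB : 0 < y + B := by positivity
  have hLy : 0 < L - y := sub_pos.mpr hyL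
  set Z := y ^ 2 / (y + B) * (1 - y / L) ^ 2 with hZ
  have hZ0 : 0 ≤ Z := by positivity
  have hr0 : 0 ≤ 1 - y / L := by
    rw [sub_nonneg, div_le_one hL]
    exact hyL.le
  have hr1 : 1 - y / L ≤ 1 := by
    have : 0 ≤ y / L := by positivity
    linarith
  have hr2 : (1 - y / L) ^ 2 ≤ 1 := pow_le_one₀ hr0 hr1
  have z1 : (1 / y ^ 2) * Z ≤ 1 / B := by
    have : (1 / y ^ 2) * Z = (1 - y / L) ^ 2 * (1 / (y + B)) := by
      rw [hZ]
      field_simp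
    rw [this]
    calc (1 - y / L) ^ 2 * (1 / (y + B)) ≤ 1 * (1 / B) := by
          gcongr
          linarith
      _ = 1 / B := one_mul _
  have z2 : (1 / (L - y) ^ 2) * Z ≤ 1 / L := by
    have : (1 / (L - y) ^ 2) * Z = y ^ 2 / ((y + B) * L ^ 2) := by
      rw [hZ, show 1 - y / L = (L - y) / L by field_simp]
      field_simp
    rw [this, div_le_div_iff₀ (by positivity) hL]
    nlinarith [mul_pos hL hL, mul_pos hB (mul_pos hL hL),
      mul_nonneg (mul_nonneg hL.le hy.le) hLy.le]
  have z3 : (2 / y - 1 / (y + B) - 2 / (L - y)) * Z ≤ 1 := by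
    have h1 : (2 / y - 1 / (y + B)) * Z
        = (1 - y / L) ^ 2 * (1 - (B / (y + B)) ^ 2) := by
      rw [hZ]
      field_simp
      ring
    have h2 : (1 - y / L) ^ 2 * (1 - (B / (y + B)) ^ 2) ≤ 1 := by
      have h3 : 1 - (B / (y + B)) ^ 2 ≤ 1 := by
        have := sq_nonneg (B / (y + B))
        linarith
      calc (1 - y / L) ^ 2 * (1 - (B / (y + B)) ^ 2) ≤ (1 - y / L) ^ 2 * 1 := by gcongr
        _ ≤ 1 := by linarith
    have h4 : 0 ≤ 2 / (L - y) * Z := by positivity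
    rw [sub_mul, h1]
    linarith
  have z4 : (2 / y - 1 / (y + B) - 2 / (L - y)) ^ 2 ≤ 8 * (1 / y ^ 2 + 1 / (L - y) ^ 2) := by
    have h1 : 0 < 1 / (y + B) := by positivity
    have h2 : 1 / (y + B) ≤ 1 / y := one_div_le_one_div_of_le hy (by linarith)
    have h3 : 0 < 1 / (L - y) := by positivity
    rw [show 2 / y = 2 * (1 / y) by ring, show 2 / (L - y) = 2 * (1 / (L - y)) by ring,
      ← one_div_pow, ← one_div_pow]
    generalize 1 / (y + B) = b at *
    generalize 1 / y = a at *
    generalize 1 / (L - y) = c at *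
    have k1 : 2 * a - b - 2 * c ≤ 2 * (a + c) := by linarith
    have k2 : -(2 * (a + c)) ≤ 2 * a - b - 2 * c := by linarith
    nlinarith [sq_nonneg (a - c), mul_nonneg (sub_nonneg.mpr k1) (neg_le_iff_add_nonneg.mp k2)]
  have z5 : κ * (2 / y ^ 2 - 1 / (y + B) ^ 2 + 2 / (L - y) ^ 2)
      ≤ 2 * κ * (1 / y ^ 2 + 1 / (L - y) ^ 2) := by
    have : 0 ≤ 1 / (y + B) ^ 2 := by positivity
    have e : 2 * κ * (1 / y ^ 2 + 1 / (L - y) ^ 2)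
        = κ * (2 / y ^ 2 + 2 / (L - y) ^ 2) := by ring
    rw [e]
    gcongr
    linarith
  set D := 2 / y - 1 / (y + B) - 2 / (L - y)
  set S := 1 / y ^ 2 + 1 / (L - y) ^ 2
  calc _ ≤ (A * (κ * D) + C * κ ^ 2 * (8 * S) + 2 * κ * S) * Z := by
        have : C * (κ * D) ^ 2 ≤ C * κ ^ 2 * (8 * S) := by
          rw [mul_pow, ← mul_assoc]
          gcongr
        gcongr
    _ = A * κ * (D * Z) + (8 * C * κ ^ 2 + 2 * κ) * ((1 / y ^ 2) * Z + (1 / (L - y) ^ 2) * Z) := by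
        ring
    _ ≤ A * κ * 1 + (8 * C * κ ^ 2 + 2 * κ) * (1 / B + 1 / L) := by gcongr
    _ = _ := by ring

variable {ρ lam τ θ q m : ℝ} {Ω : Set (EuclideanSpace ℝ (Fin N))}
  {u : EuclideanSpace ℝ (Fin N) → ℝ} {t : ℝ}

lemma continuousOn_sub_log_norm (s : Set 𝔼) :
    ContinuousOn (fun x : 𝔼 => t - log ‖x‖) (s \ {0}) := fun _ hx =>
  (continuousAt_const.sub (hasFDerivAt_log_norm hx.2).continuousAt).continuousWithinAt

lemma log_norm_le_of_mem {x : 𝔼} (hx : x ∈ Metric.closedBall (0 : 𝔼) (exp t) \ {0}) :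
    log ‖x‖ ≤ t :=
  (log_le_iff_le_exp (norm_pos_iff.mpr hx.2)).mpr (mem_closedBall_zero_iff.mp hx.1)

lemma mem_of_log_norm_le (hball : Metric.closedBall 0 (exp t) ⊆ Ω) {x : 𝔼} (hx : x ≠ 0)
    (hxt : log ‖x‖ ≤ t) : x ∈ Ω \ {0} :=
  ⟨hball (mem_closedBall_zero_iff.mpr ((log_le_iff_le_exp (norm_pos_iff.mpr hx)).mp hxt)), hx⟩

lemma IsSolutionE.scaled_mul_weight_le (hτ1 : τ < 1) (hq : 1 < q) (hΩ : IsOpen Ω)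
    (hu : IsSolutionE N ρ lam τ θ q Ω u) (hm : θ + 2 = -m * (q - 1))
    (hball : Metric.closedBall 0 (exp t) ⊆ Ω) {A C : ℝ} (hA : 0 < A) (hC : 0 ≤ C)
    (hF : ∀ p, fRho ρ lam τ (-(m + p)) ≤ A * p + C * p ^ 2) {L B : ℝ} (hB : 0 < B)
    {x : 𝔼} (hx : x ≠ 0) (hxt : log ‖x‖ < t) (hxL : t - L < log ‖x‖) :
    scaled θ q u x * ((t - log ‖x‖) ^ 2 / (t - log ‖x‖ + B) * (1 - (t - log ‖x‖) / L) ^ 2)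
      ≤ A * (1 / (q - 1)) + (8 * C * (1 / (q - 1)) ^ 2 + 2 * (1 / (q - 1))) * (1 / B + 1 / L) := by
  have hq' : 0 < q - 1 := by linarith
  set κ := 1 / (q - 1) with hκdef
  have hκ : 0 < κ := by positivity
  have hκq : κ * (q - 1) = 1 := by rw [hκdef]; field_simp
  have hL : 0 < L := by linarith
  set V : 𝔼 → ℝ := fun x => scaled θ q u x *
    ((t - log ‖x‖) ^ 2 / (t - log ‖x‖ + B) * (1 - (t - log ‖x‖) / L) ^ 2) with hV
  have hVc : ContinuousOn V (Metric.closedBall 0 (exp t) \ {0}) := by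
    have hl := continuousOn_sub_log_norm (t := t) (Metric.closedBall (0 : 𝔼) (exp t))
    refine ((continuousOn_scaled hu.1).mono (Set.sdiff_subset_sdiff_left hball)).mul
      (((hl.pow 2).div (hl.add continuousOn_const) fun y hy => ?_).mul
        ((continuousOn_const.sub (hl.div_const L)).pow 2))
    have := log_norm_le_of_mem hy
    exact (by linarith : 0 < t - log ‖y‖ + B).ne'
  have hpos : ∀ y : 𝔼, y ≠ 0 → log ‖y‖ < t → t - L < log ‖y‖ → 0 < V y := by
    intro y hy hyt hyL
    have h1 := scaled_pos (θ := θ) (q := q) hu.1 (mem_of_log_norm_le hball hy hyt.le)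
    have h2 : 0 < t - log ‖y‖ := by linarith
    have h3 : 0 < 1 - (t - log ‖y‖) / L := by
      rw [sub_pos, div_lt_one hL]
      linarith
    simp only [hV]
    positivity
  obtain ⟨x₀, h0, hb, ht, hle, hmax⟩ := exists_isLocalMax_annulus hVc hx hxL hxt (by
    rintro y hy (h | h)
    · refine lt_of_eq_of_lt ?_ (hpos x hx hxt hxL)
      simp [hV, h, hL.ne']
    · refine lt_of_eq_of_lt ?_ (hpos x hx hxt hxL)
      simp [hV, h])
  have hlogV : ∀ y : 𝔼, y ≠ 0 → log ‖y‖ < t → t - L < log ‖y‖ →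
      log (u y) - (m * log ‖y‖ + (-2 * κ) * log (t - log ‖y‖) + κ * log (t + B - log ‖y‖)
        + (-2 * κ) * log (log ‖y‖ - (t - L))) = κ * log (V y) + 2 * κ * log L := by
    intro y hy hyt hyL
    have hyΩ := mem_of_log_norm_le hball hy hyt.le
    have h2 : 0 < t - log ‖y‖ := by linarith
    have h3 : 0 < log ‖y‖ - (t - L) := by linarith
    have h4 : 0 < t - log ‖y‖ + B := by linarith
    have e3 : 1 - (t - log ‖y‖) / L = (log ‖y‖ - (t - L)) / L := by
      field_simp
      ring
    have e4 : t + B - log ‖y‖ = t - log ‖y‖ + B := by ring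
    simp only [hV]
    rw [log_mul (scaled_pos hu.1 hyΩ).ne' (by rw [e3]; positivity), log_scaled hm hu.1 hyΩ,
      log_mul (by positivity) (by rw [e3]; positivity), log_div (by positivity) h4.ne', log_pow,
      log_pow, e3, log_div h3.ne' hL.ne', e4]
    push_cast
    linear_combination (-(log (u y) - m * log ‖y‖)) * hκq
  have hloc : IsLocalMax (fun x => log (u x) - (m * log ‖x‖ + (-2 * κ) * log (t - log ‖x‖)
      + κ * log (t + B - log ‖x‖) + (-2 * κ) * log (log ‖x‖ - (t - L)))) x₀ := by
    have hc : ContinuousAt (fun x : 𝔼 => log ‖x‖) x₀ := (hasFDerivAt_log_norm h0).continuousAt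
    filter_upwards [hmax, hc.eventually (lt_mem_nhds hb), hc.eventually (gt_mem_nhds ht),
      isOpen_ne.mem_nhds h0] with y hy hy1 hy2 hy3
    rw [hlogV y hy3 hy2 hy1, hlogV x₀ h0 ht hb]
    have := log_le_log (hpos y hy3 hy2 hy1) hy
    gcongr
  have htest := (hu.log_barrier_test hτ1 hΩ (mem_of_log_norm_le hball h0 ht.le) m (-2 * κ) κ
    (-2 * κ) rfl ht (show log ‖x₀‖ < t + B by linarith) hb).1 hloc
  set y := t - log ‖x₀‖ with hy
  have hy0 : 0 < y := sub_pos.mpr ht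
  have hyL : y < L := by linarith
  have e1 : t + B - log ‖x₀‖ = y + B := by rw [hy]; ring
  have e2 : log ‖x₀‖ - (t - L) = L - y := by rw [hy]; ring
  rw [e1, e2] at htest
  set p := κ * (2 / y - 1 / (y + B) - 2 / (L - y)) with hp
  have e3 : -(-2 * κ) / y - κ / (y + B) + -2 * κ / (L - y) = p := by rw [hp]; ring
  have e4 : -(-2 * κ) / y ^ 2 - κ / (y + B) ^ 2 - -2 * κ / (L - y) ^ 2
      = κ * (2 / y ^ 2 - 1 / (y + B) ^ 2 + 2 / (L - y) ^ 2) := by ring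
  rw [e3, e4] at htest
  have hZ : 0 ≤ y ^ 2 / (y + B) * (1 - y / L) ^ 2 := by positivity
  calc V x ≤ V x₀ := hle
    _ ≤ (A * p + C * p ^ 2 + κ * (2 / y ^ 2 - 1 / (y + B) ^ 2 + 2 / (L - y) ^ 2))
        * (y ^ 2 / (y + B) * (1 - y / L) ^ 2) :=
      mul_le_mul_of_nonneg_right (by unfold scaled; linarith [hF p]) hZ
    _ ≤ _ := upper_barrier_estimate hy0 hyL hB hκ hA hC

lemma tendsto_one_sub_div_pow (y : ℝ) (k : ℕ) :
    Tendsto (fun L : ℝ => (1 - y / L) ^ k) atTop (𝓝 1) := by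
  simpa using ((tendsto_const_nhds (x := (1 : ℝ))).sub
    (tendsto_const_nhds (x := y).div_atTop tendsto_id)).pow k

lemma IsSolutionE.scaled_mul_le (hτ1 : τ < 1) (hq : 1 < q) (hΩ : IsOpen Ω)
    (hu : IsSolutionE N ρ lam τ θ q Ω u) (hm : θ + 2 = -m * (q - 1))
    (hball : Metric.closedBall 0 (exp t) ⊆ Ω) {A C : ℝ} (hA : 0 < A) (hC : 0 ≤ C)
    (hF : ∀ p, fRho ρ lam τ (-(m + p)) ≤ A * p + C * p ^ 2) {B : ℝ} (hB : 0 < B)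
    {x : 𝔼} (hx : x ≠ 0) (hxt : log ‖x‖ < t) :
    scaled θ q u x * ((t - log ‖x‖) ^ 2 / (t - log ‖x‖ + B))
      ≤ A * (1 / (q - 1)) + (8 * C * (1 / (q - 1)) ^ 2 + 2 * (1 / (q - 1))) * (1 / B) := by
  have h1 : Tendsto (fun L : ℝ => scaled θ q u x *
      ((t - log ‖x‖) ^ 2 / (t - log ‖x‖ + B) * (1 - (t - log ‖x‖) / L) ^ 2)) atTop
      (𝓝 (scaled θ q u x * ((t - log ‖x‖) ^ 2 / (t - log ‖x‖ + B) * 1))) :=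
    ((tendsto_one_sub_div_pow _ 2).const_mul _).const_mul _
  have h2 : Tendsto (fun L : ℝ => A * (1 / (q - 1))
      + (8 * C * (1 / (q - 1)) ^ 2 + 2 * (1 / (q - 1))) * (1 / B + 1 / L)) atTop
      (𝓝 (A * (1 / (q - 1))
        + (8 * C * (1 / (q - 1)) ^ 2 + 2 * (1 / (q - 1))) * (1 / B + 0))) :=
    (((tendsto_const_nhds.div_atTop tendsto_id).const_add _).const_mul _).const_add _
  rw [mul_one] at h1
  rw [add_zero] at h2
  refine le_of_tendsto_of_tendsto h1 h2 ?_
  filter_upwards [eventually_gt_atTop (t - log ‖x‖)] with L hL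
  exact hu.scaled_mul_weight_le hτ1 hq hΩ hm hball hA hC hF hB hx hxt (by linarith)

lemma IsSolutionE.le_scaled_mul_weight (hτ1 : τ < 1) (hq : 1 < q) (hΩ : IsOpen Ω)
    (hu : IsSolutionE N ρ lam τ θ q Ω u) (hm : θ + 2 = -m * (q - 1))
    (hball : Metric.closedBall 0 (exp t) ⊆ Ω) {A B : ℝ} (hA : 0 < A) (hB : 0 < B) {k : ℕ}
    (hk : k ≠ 0)
    (hF : ∀ a b, 0 ≤ a → 0 ≤ b → a ≤ 1 / (q - 1) / B →
      A * a + b ^ 2 / (1 / (q - 1) * k) ≤ fRho ρ lam τ (-(m + (a + b))))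
    (hbd : ∀ z : 𝔼, z ≠ 0 → log ‖z‖ = t → A * (1 / (q - 1)) ≤ scaled θ q u z * B)
    {L : ℝ} {x : 𝔼} (hx : x ≠ 0) (hxt : log ‖x‖ < t) (hxL : t - L < log ‖x‖) :
    A * (1 / (q - 1)) * (1 - (t - log ‖x‖) / L) ^ k ≤ scaled θ q u x * (t - log ‖x‖ + B) := by
  have hq' : 0 < q - 1 := by linarith
  set κ := 1 / (q - 1) with hκdef
  have hκ : 0 < κ := by positivity
  have hκq : κ * (q - 1) = 1 := by rw [hκdef]; field_simp
  have hkpos : (0 : ℝ) < k := by exact_mod_cast Nat.pos_of_ne_zero hk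
  have hL : 0 < L := by linarith
  set V : 𝔼 → ℝ := fun x =>
    (1 - (t - log ‖x‖) / L) ^ k / (scaled θ q u x * (t - log ‖x‖ + B)) with hV
  have hden : ∀ y : 𝔼, y ≠ 0 → log ‖y‖ ≤ t → 0 < scaled θ q u y * (t - log ‖y‖ + B) := by
    intro y hy hyt
    exact mul_pos (scaled_pos hu.1 (mem_of_log_norm_le hball hy hyt)) (by linarith)
  have hVc : ContinuousOn V (Metric.closedBall 0 (exp t) \ {0}) := by
    have hl := continuousOn_sub_log_norm (t := t) (Metric.closedBall (0 : 𝔼) (exp t))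
    exact ((continuousOn_const.sub (hl.div_const L)).pow k).div
      (((continuousOn_scaled hu.1).mono (Set.sdiff_subset_sdiff_left hball)).mul
        (hl.add continuousOn_const)) fun y hy => (hden y hy.2 (log_norm_le_of_mem hy)).ne'
  have hnum : ∀ y : 𝔼, t - L < log ‖y‖ → 0 < 1 - (t - log ‖y‖) / L := by
    intro y hy
    rw [sub_pos, div_lt_one hL]
    linarith
  have hpos : ∀ y : 𝔼, y ≠ 0 → log ‖y‖ < t → t - L < log ‖y‖ → 0 < V y := fun y hy hyt hyL =>
    div_pos (pow_pos (hnum y hyL) k) (hden y hy hyt.le)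
  by_contra! hcon
  have hVx : 1 / (A * κ) < V x := by
    rw [div_lt_div_iff₀ (by positivity) (hden x hx hxt.le)]
    linarith
  obtain ⟨x₀, h0, hb, ht, hle, hmax⟩ := exists_isLocalMax_annulus hVc hx hxL hxt (by
    rintro y hy (h | h)
    · refine lt_of_eq_of_lt ?_ (hpos x hx hxt hxL)
      simp [hV, h, hL.ne', hk]
    · refine lt_of_le_of_lt ?_ hVx
      have h1 : V y = 1 / (scaled θ q u y * B) := by simp [hV, h]
      rw [h1]
      exact one_div_le_one_div_of_le (by positivity) (hbd y hy h))
  have hlogV : ∀ y : 𝔼, y ≠ 0 → log ‖y‖ < t → t - L < log ‖y‖ →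
      log (u y) - (m * log ‖y‖ + 0 * log (t - log ‖y‖) + (-κ) * log (t + B - log ‖y‖)
        + (κ * k) * log (log ‖y‖ - (t - L))) = -(κ * log (V y)) - κ * k * log L := by
    intro y hy hyt hyL
    have hyΩ := mem_of_log_norm_le hball hy hyt.le
    have h3 : 0 < log ‖y‖ - (t - L) := by linarith
    have h4 : 0 < t - log ‖y‖ + B := by linarith
    have e3 : 1 - (t - log ‖y‖) / L = (log ‖y‖ - (t - L)) / L := by
      field_simp
      ring
    have e4 : t + B - log ‖y‖ = t - log ‖y‖ + B := by ring
    simp only [hV]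
    rw [log_div (pow_pos (hnum y hyL) k).ne' (hden y hy hyt.le).ne', log_pow, e3,
      log_div h3.ne' hL.ne', log_mul (scaled_pos hu.1 hyΩ).ne' h4.ne', log_scaled hm hu.1 hyΩ, e4]
    linear_combination (-(log (u y) - m * log ‖y‖)) * hκq
  have hloc : IsLocalMin (fun x => log (u x) - (m * log ‖x‖ + 0 * log (t - log ‖x‖)
      + (-κ) * log (t + B - log ‖x‖) + (κ * k) * log (log ‖x‖ - (t - L)))) x₀ := by
    have hc : ContinuousAt (fun x : 𝔼 => log ‖x‖) x₀ := (hasFDerivAt_log_norm h0).continuousAt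
    filter_upwards [hmax, hc.eventually (lt_mem_nhds hb), hc.eventually (gt_mem_nhds ht),
      isOpen_ne.mem_nhds h0] with y hy hy1 hy2 hy3
    rw [hlogV y hy3 hy2 hy1, hlogV x₀ h0 ht hb]
    have := log_le_log (hpos y hy3 hy2 hy1) hy
    gcongr
  have htest := (hu.log_barrier_test hτ1 hΩ (mem_of_log_norm_le hball h0 ht.le) m 0 (-κ)
    (κ * k) rfl ht (show log ‖x₀‖ < t + B by linarith) hb).2 hloc
  set y := t - log ‖x₀‖ with hy
  have hy0 : 0 < y := sub_pos.mpr ht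
  have hyL : 0 < L - y := by linarith
  have e1 : t + B - log ‖x₀‖ = y + B := by rw [hy]; ring
  have e2 : log ‖x₀‖ - (t - L) = L - y := by rw [hy]; ring
  rw [e1, e2] at htest
  have e3 : -0 / y - -κ / (y + B) + κ * k / (L - y) = κ / (y + B) + κ * k / (L - y) := by ring
  have e4 : -0 / y ^ 2 - -κ / (y + B) ^ 2 - κ * k / (L - y) ^ 2
      = κ / (y + B) ^ 2 - (κ * k / (L - y)) ^ 2 / (κ * k) := by
    field_simp
    ring
  rw [e3, e4] at htest
  have hFx := hF (κ / (y + B)) (κ * k / (L - y)) (by positivity) (by positivity)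
    (by gcongr; linarith)
  have hT : A * (κ / (y + B)) ≤ scaled θ q u x₀ := by
    have : 0 ≤ κ / (y + B) ^ 2 := by positivity
    unfold scaled
    linarith
  have hT' : A * κ ≤ scaled θ q u x₀ * (y + B) := by
    have : A * (κ / (y + B)) * (y + B) = A * κ := by field_simp
    rw [← this]
    gcongr
  have hVx₀ : V x₀ ≤ 1 / (A * κ) := by
    have h1 : (1 - y / L) ^ k ≤ 1 := by
      refine pow_le_one₀ (hnum x₀ hb).le ?_
      have : 0 ≤ y / L := by positivity
      linarith
    calc V x₀ = (1 - y / L) ^ k / (scaled θ q u x₀ * (y + B)) := rfl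
      _ ≤ 1 / (A * κ) := by gcongr
  linarith

lemma IsSolutionE.le_scaled_mul (hτ1 : τ < 1) (hq : 1 < q) (hΩ : IsOpen Ω)
    (hu : IsSolutionE N ρ lam τ θ q Ω u) (hm : θ + 2 = -m * (q - 1))
    (hball : Metric.closedBall 0 (exp t) ⊆ Ω) {A B : ℝ} (hA : 0 < A) (hB : 0 < B) {k : ℕ}
    (hk : k ≠ 0)
    (hF : ∀ a b, 0 ≤ a → 0 ≤ b → a ≤ 1 / (q - 1) / B →
      A * a + b ^ 2 / (1 / (q - 1) * k) ≤ fRho ρ lam τ (-(m + (a + b))))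
    (hbd : ∀ z : 𝔼, z ≠ 0 → log ‖z‖ = t → A * (1 / (q - 1)) ≤ scaled θ q u z * B)
    {x : 𝔼} (hx : x ≠ 0) (hxt : log ‖x‖ < t) :
    A * (1 / (q - 1)) ≤ scaled θ q u x * (t - log ‖x‖ + B) := by
  have h1 := (tendsto_one_sub_div_pow (t - log ‖x‖) k).const_mul (A * (1 / (q - 1)))
  rw [mul_one] at h1
  refine le_of_tendsto h1 ?_
  filter_upwards [eventually_gt_atTop (t - log ‖x‖)] with L hL
  exact hu.le_scaled_mul_weight hτ1 hq hΩ hm hball hA hB hk hF hbd hx hxt (by linarith)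

/-- The differential inequality required of the lower barrier holds for all large parameters. -/
lemma exists_lower_barrier_parameters {F : ℝ → ℝ} {A A' C c κ : ℝ} (hκ : 0 < κ) (hA' : 0 < A')
    (hAA' : A' < A) (hC : 0 ≤ C) (hc : 0 < c) (hF : ∀ p, A * p - C * p ^ 2 ≤ F p)
    (hF' : ∀ p, 0 ≤ p → c * (p + p ^ 2) ≤ F p) :
    ∃ k : ℕ, k ≠ 0 ∧ ∀ᶠ B in atTop, ∀ a b, 0 ≤ a → 0 ≤ b → a ≤ κ / B →
      A' * a + b ^ 2 / (κ * k) ≤ F (a + b) := by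
  obtain ⟨k, hk⟩ := exists_nat_gt (1 / (κ * c))
  have hk0 : (0 : ℝ) < k := lt_trans (by positivity) hk
  refine ⟨k, by exact_mod_cast hk0.ne', ?_⟩
  set δ := (A - A') / (C + c) with hδ
  have hδ0 : 0 < δ := div_pos (by linarith) (by linarith)
  have hδ' : (C + c) * δ = A - A' := by rw [hδ]; field_simp
  filter_upwards [eventually_gt_atTop 0, eventually_ge_atTop (κ * A' / (c * δ))] with B hB hB'
  intro a b ha hb haB
  have hbk : b ^ 2 / (κ * k) ≤ c * (a + b) ^ 2 := by
    have h1 : 1 ≤ κ * k * c := by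
      rw [div_lt_iff₀ (by positivity)] at hk
      linarith
    rw [div_le_iff₀ (by positivity)]
    have h2 : b ^ 2 ≤ (a + b) ^ 2 := by gcongr; linarith
    nlinarith [sq_nonneg (a + b)]
  rcases le_or_gt (a + b) δ with h | h
  · have h1 := hF (a + b)
    have h2 : (C + c) * (a + b) ^ 2 ≤ (A - A') * (a + b) := by
      rw [← hδ', sq, ← mul_assoc, mul_assoc _ δ, mul_comm δ, ← mul_assoc]
      gcongr
    nlinarith
  · have h1 := hF' (a + b) (by linarith)
    have h2 : A' * a ≤ c * δ := by
      rw [div_le_iff₀ (by positivity)] at hB'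
      rw [le_div_iff₀ hB] at haB
      have h3 : A' * a * B ≤ c * δ * B := by nlinarith
      exact le_of_mul_le_mul_right h3 hB
    nlinarith

lemma tendsto_add_div_add_atTop (b c : ℝ) :
    Tendsto (fun s : ℝ => (s + b) / (s + c)) atTop (𝓝 1) := by
  have h1 : Tendsto (fun s : ℝ => 1 + (b - c) / (s + c)) atTop (𝓝 (1 + 0)) :=
    (tendsto_const_nhds.div_atTop (tendsto_atTop_add_const_right _ c tendsto_id)).const_add 1
  rw [add_zero] at h1
  refine h1.congr' ?_
  filter_upwards [eventually_gt_atTop (-c)] with s hs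
  have : s + c ≠ 0 := by linarith
  field_simp
  ring

lemma exists_closedBall_exp_subset (hΩ : IsOpen Ω) (h0 : (0 : 𝔼) ∈ Ω) :
    ∃ t, Metric.closedBall (0 : 𝔼) (exp t) ⊆ Ω := by
  obtain ⟨r, hr, hs⟩ := Metric.nhds_basis_closedBall.mem_iff.mp (hΩ.mem_nhds h0)
  exact ⟨log r, by rwa [exp_log hr]⟩

/-- A positive lower bound for `scaled` on a sphere. -/
lemma exists_pos_le_scaled (hu : PosC1 Ω u) (hball : Metric.closedBall 0 (exp t) ⊆ Ω) :
    ∃ d > 0, ∀ z : 𝔼, z ≠ 0 → log ‖z‖ = t → d ≤ scaled θ q u z := by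
  have hsub : Metric.sphere (0 : 𝔼) (exp t) ⊆ Ω \ {0} := by
    intro z hz
    refine ⟨hball (Metric.sphere_subset_closedBall hz), ?_⟩
    rintro rfl
    rw [mem_sphere_zero_iff_norm, norm_zero] at hz
    exact (exp_pos t).ne hz
  rcases (Metric.sphere (0 : 𝔼) (exp t)).eq_empty_or_nonempty with he | hne
  · refine ⟨1, one_pos, fun z hz hzt => ?_⟩
    have : z ∈ Metric.sphere (0 : 𝔼) (exp t) := by
      rw [mem_sphere_zero_iff_norm, ← hzt, exp_log (norm_pos_iff.mpr hz)]
    simp [he] at this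
  · obtain ⟨z₀, hz₀, hmin⟩ := (isCompact_sphere _ _).exists_isMinOn hne
      ((continuousOn_scaled (θ := θ) (q := q) hu).mono hsub)
    refine ⟨scaled θ q u z₀, scaled_pos hu (hsub hz₀), fun z hz hzt => hmin ?_⟩
    rw [mem_sphere_zero_iff_norm, ← hzt, exp_log (norm_pos_iff.mpr hz)]

/-- `|x|^(θ+2) u^(q-1) |log|x||` converges as `x → 0`. -/
theorem IsSolutionE.tendsto_scaled_mul_log (hτ1 : τ < 1) (hq : 1 < q) (hΩ : IsOpen Ω)
    (h0 : (0 : 𝔼) ∈ Ω) (hu : IsSolutionE N ρ lam τ θ q Ω u) (hm : θ + 2 = -m * (q - 1))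
    {A C c : ℝ} (hA : 0 < A) (hC : 0 ≤ C) (hc : 0 < c)
    (hF : ∀ p, |fRho ρ lam τ (-(m + p)) - A * p| ≤ C * p ^ 2)
    (hF' : ∀ p, 0 ≤ p → c * (p + p ^ 2) ≤ fRho ρ lam τ (-(m + p))) :
    Tendsto (fun x : 𝔼 => scaled θ q u x * -log ‖x‖) (𝓝[≠] 0) (𝓝 (A * (1 / (q - 1)))) := by
  obtain ⟨t, hball⟩ := exists_closedBall_exp_subset hΩ h0
  have hκ : 0 < 1 / (q - 1) := one_div_pos.mpr (by linarith)
  have hs : Tendsto (fun x : 𝔼 => -log ‖x‖) (𝓝[≠] 0) atTop := by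
    refine tendsto_neg_atBot_atTop.comp (tendsto_log_nhdsGT_zero.comp ?_)
    exact tendsto_norm_nhdsNE_zero
  have hne : ∀ᶠ x : 𝔼 in 𝓝[≠] 0, x ≠ 0 := eventually_mem_nhdsWithin
  have hlarge : ∀ᶠ x : 𝔼 in 𝓝[≠] 0, 0 < -log ‖x‖ ∧ log ‖x‖ < t :=
    (hs.eventually_gt_atTop 0).and ((hs.eventually_gt_atTop (-t)).mono fun x hx => by linarith)
  set κ := 1 / (q - 1) with hκdef
  rw [tendsto_order]
  constructor
  · intro a ha
    obtain ⟨A', hA'1, hA'2⟩ : ∃ A', max 0 (a / κ) < A' ∧ A' < A :=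
      exists_between (max_lt hA ((div_lt_iff₀ hκ).mpr ha))
    have hA' : 0 < A' := (le_max_left _ _).trans_lt hA'1
    have haA' : a < A' * κ := (div_lt_iff₀ hκ).mp ((le_max_right _ _).trans_lt hA'1)
    obtain ⟨k, hk, hbar⟩ := exists_lower_barrier_parameters
      (F := fun p => fRho ρ lam τ (-(m + p))) hκ hA' hA'2 hC hc
      (fun p => by linarith [(abs_le.mp (hF p)).1]) hF'
    obtain ⟨d, hd, hdle⟩ := exists_pos_le_scaled (θ := θ) (q := q) hu.1 hball
    obtain ⟨B, hbarB, hB, hBd⟩ := (hbar.and ((eventually_gt_atTop 0).and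
      (eventually_ge_atTop (A' * κ / d)))).exists
    have hlim : Tendsto (fun x : 𝔼 => A' * κ * ((-log ‖x‖ + 0) / (-log ‖x‖ + (t + B))))
        (𝓝[≠] 0) (𝓝 (A' * κ * 1)) :=
      ((tendsto_add_div_add_atTop 0 (t + B)).comp hs).const_mul _
    rw [mul_one] at hlim
    filter_upwards [hne, hlarge, hlim.eventually (lt_mem_nhds haA')] with x hx hxt hxa
    refine hxa.trans_le ?_
    have key := hu.le_scaled_mul hτ1 hq hΩ hm hball hA' hB hk hbarB (fun z hz hzt => by
      rw [div_le_iff₀ hd] at hBd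
      have := mul_le_mul_of_nonneg_right (hdle z hz hzt) hB.le
      linarith) hx hxt.2
    have hden : 0 < -log ‖x‖ + (t + B) := by linarith
    rw [add_zero, mul_div_assoc', div_le_iff₀ hden]
    calc A' * κ * -log ‖x‖ ≤ scaled θ q u x * (t - log ‖x‖ + B) * -log ‖x‖ := by
          have := hxt.1
          gcongr
      _ = _ := by ring
  · intro a ha
    set K := 8 * C * κ ^ 2 + 2 * κ with hK
    have hK0 : 0 < K := by positivity
    obtain ⟨B, hB, hBa⟩ : ∃ B > 0, A * κ + K * (1 / B) < a := by
      refine ⟨2 * K / (a - A * κ), div_pos (by linarith) (by linarith), ?_⟩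
      have : 0 < a - A * κ := by linarith
      have e : K * (1 / (2 * K / (a - A * κ))) = (a - A * κ) / 2 := by field_simp
      rw [e]
      linarith
    have hlim : Tendsto (fun x : 𝔼 => (A * κ + K * (1 / B)) *
        ((-log ‖x‖ + 0) / (-log ‖x‖ + t) * ((-log ‖x‖ + (t + B)) / (-log ‖x‖ + t))))
        (𝓝[≠] 0) (𝓝 ((A * κ + K * (1 / B)) * (1 * 1))) :=
      (((tendsto_add_div_add_atTop 0 t).comp hs).mul
        ((tendsto_add_div_add_atTop (t + B) t).comp hs)).const_mul _
    rw [mul_one, mul_one] at hlim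
    filter_upwards [hne, hlarge, hlim.eventually (gt_mem_nhds hBa)] with x hx hxt hxa
    refine lt_of_le_of_lt ?_ hxa
    have key := hu.scaled_mul_le hτ1 hq hΩ hm hball hA hC
      (fun p => by linarith [(abs_le.mp (hF p)).2]) hB hx hxt.2
    have hy : 0 < -log ‖x‖ + t := by linarith
    have hden : 0 < -log ‖x‖ + (t + B) := by linarith
    have hs0 := hxt.1
    calc scaled θ q u x * -log ‖x‖
        = scaled θ q u x * ((t - log ‖x‖) ^ 2 / (t - log ‖x‖ + B)) *
          ((-log ‖x‖ + 0) / (-log ‖x‖ + t) * ((-log ‖x‖ + (t + B)) / (-log ‖x‖ + t))) := by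
          rw [show t - log ‖x‖ + B = -log ‖x‖ + (t + B) by ring,
            show t - log ‖x‖ = -log ‖x‖ + t by ring, add_zero]
          field_simp
      _ ≤ _ := by gcongr

end Bounds

/-- If `β = ϖ₁` in Case [N₁], or in Case [N₂] with `ρ ≠ Υ`, then every
positive solution `u` of (E) in `Ω \ {0}` satisfies
`|x|^{ϖ₁} |log|x||^{1/(q-1)} u(x) → (|ϖ₁|(1 - λτ|ϖ₁|^{-τ-1})/(q-1))^{1/(q-1)}`
as `|x| → 0`. -/
theorem stmt11_critical_beta
    (N : ℕ) (hN : 2 ≤ N) (ρ lam τ θ q : ℝ)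
    (hτ0 : 0 ≤ τ) (hτ1 : τ < 1) (hq : 1 < q)
    (Ω : Set (EuclideanSpace ℝ (Fin N))) (hΩ : IsOpen Ω) (h0 : (0 : EuclideanSpace ℝ (Fin N)) ∈ Ω)
    (hcase : CaseN1 ρ lam τ ∨ (CaseN2 ρ lam τ ∧ ρ ≠ Upsilon lam τ))
    (w1 : ℝ) (hw1 : IsMinNegRoot ρ lam τ w1)
    (hβ : (θ + 2) / (q - 1) = w1)
    (u : EuclideanSpace ℝ (Fin N) → ℝ)
    (hu : IsSolutionE N ρ lam τ θ q Ω u) :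
    Filter.Tendsto (fun x : EuclideanSpace ℝ (Fin N) =>
        ‖x‖ ^ w1 * |Real.log ‖x‖| ^ (1 / (q - 1)) * u x)
      (𝓝[≠] (0 : EuclideanSpace ℝ (Fin N)))
      (𝓝 ((|w1| * (1 - lam * τ * |w1| ^ (-τ - 1)) / (q - 1)) ^ (1 / (q - 1)))) := by
  have hq' : 0 < q - 1 := by linarith
  obtain ⟨m, rfl⟩ : ∃ m, w1 = -m := ⟨-w1, by ring⟩
  have hm : 0 < m := neg_lt_zero.mp hw1.1
  have hθ : θ + 2 = -m * (q - 1) := (div_eq_iff hq'.ne').mp hβ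
  have hslope := hw1.slope_pos hτ0 hcase hm
  obtain ⟨c, hc, hF'⟩ := exists_le_fRho hτ0 hτ1 hm hw1.2.1 hslope
  have hQ : 0 < m ^ (-τ - 1) := rpow_pos_of_pos hm _
  have key := hu.tendsto_scaled_mul_log hτ1 hq hΩ h0 hθ (mul_pos hm hslope)
    (C := 1 + 2 * |lam| * m ^ (-τ - 1)) (by positivity) hc
    (abs_fRho_sub_le hτ0 hτ1 hm hw1.2.1) hF'
  rw [abs_neg, abs_of_pos hm, div_eq_mul_one_div (m * _)]
  refine (key.rpow_const (p := 1 / (q - 1)) (Or.inr (by positivity))).congr' ?_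
  have hsmall : ∀ᶠ x : EuclideanSpace ℝ (Fin N) in 𝓝[≠] 0, x ∈ Ω ∧ ‖x‖ < 1 :=
    ((hΩ.eventually_mem h0).and (tendsto_norm_zero.eventually (gt_mem_nhds one_pos))).filter_mono
      nhdsWithin_le_nhds
  filter_upwards [hsmall, eventually_mem_nhdsWithin] with x hx hx0
  have hn : 0 < ‖x‖ := norm_pos_iff.mpr hx0
  have hux : 0 < u x := hu.1.2 x ⟨hx.1, hx0⟩
  have hlog : log ‖x‖ < 0 := log_neg hn hx.2
  have e1 : (q - 1) * (1 / (q - 1)) = 1 := mul_one_div_cancel hq'.ne'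
  rw [scaled, mul_rpow (by positivity) (by linarith), mul_rpow (by positivity) (by positivity),
    ← rpow_mul hn.le, ← rpow_mul hux.le, hθ, mul_assoc (-m), e1, mul_one, rpow_one,
    abs_of_neg hlog]
  ring

end
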